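/- arXiv:0705.4058 — 2 statements merged into one kernel-verified Lean document; each statement's English description precedes it below -/
import Mathlib

section
/- Let U be a C¹ function on the closure of Ω_ε vanishing on the boundary of Ω_ε, and suppose ∫₀^{ε h(x)} U(x,y) sin(π y/(ε h(x))) dy = 0 for almost every x ∈ I. Then ∫_{Ω_ε} U² dx dy ≤ (M² ε²/(3π²)) ∫_{Ω_ε} ( |∇U|² − (π²/(M² ε²)) U² ) dx dy. -/
open MeasureTheory Real Set intervalIntegral

/-- `|∇U|² = (∂ₓU)² + (∂_yU)²` for a function `U : ℝ² → ℝ`. -/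
noncomputable def gradSq (U : ℝ × ℝ → ℝ) (p : ℝ × ℝ) : ℝ :=
  (deriv (fun s => U (s, p.2)) p.1) ^ 2 + (deriv (fun t => U (p.1, t)) p.2) ^ 2

lemma aux_split {E : Type*} [NormedAddCommGroup E] [NormedSpace ℝ E] (F : ℝ → E)
    (hF : Continuous F) (L : ℝ) :
    ∫ x in (-L)..L, F x = ∫ x in (0:ℝ)..L, (F (-x) + F x) := by
  have hF' : Continuous (fun x => F (-x)) := hF.comp continuous_neg
  rw [intervalIntegral.integral_add (hF'.intervalIntegrable _ _)
    (hF.intervalIntegrable _ _), intervalIntegral.integral_comp_neg, neg_zero,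
    intervalIntegral.integral_add_adjacent_intervals (hF.intervalIntegrable _ _)
    (hF.intervalIntegrable _ _)]

lemma aux_coeff_zero (L : ℝ) (hL : 0 < L) (hab : -L < L) (V : ℝ → ℝ) (hV : Continuous V)
    (hodd : ∀ x, V (-x) = - V x)
    (horth : ∫ y in (0:ℝ)..L, V y * Real.sin (π * y / L) = 0)
    (n : ℤ) (hn : n = 0 ∨ n = 1 ∨ n = -1) :
    fourierCoeffOn hab (fun x => (V x : ℂ)) n = 0 := by
  rw [fourierCoeffOn_eq_integral]
  have hc : Continuous (fun x : ℝ => (fourier (-n) (x : AddCircle (L - -L))) • (V x : ℂ)) := by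
    simp only [fourier_coe_apply]
    fun_prop
  rw [aux_split _ hc]
  have key : ∀ x : ℝ, ((fourier (-n) ((-x : ℝ) : AddCircle (L - -L))) • (V (-x) : ℂ) +
      (fourier (-n) (x : AddCircle (L - -L))) • (V x : ℂ)) =
      (-2 * n * Complex.I) * ((V x * Real.sin (π * x / L) : ℝ) : ℂ) := by
    intro x
    simp only [fourier_coe_apply, hodd, smul_eq_mul]
    have hLc : (L : ℂ) ≠ 0 := by exact_mod_cast hL.ne'
    have e : ∀ m z : ℂ, 2 * (π:ℂ) * Complex.I * m * z / ((L - -L : ℝ) : ℂ) = 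
       (m * (π * z / L)) * Complex.I := by
      intro m z; push_cast; field_simp; ring
    rw [e, e]
    simp only [Complex.exp_mul_I]
    rcases hn with rfl | rfl | rfl
    · simp
    · simp [neg_div, mul_neg]; ring
    · simp [neg_div, mul_neg]; ring
  simp only [key]
  rw [intervalIntegral.integral_const_mul, intervalIntegral.integral_ofReal, horth]
  simp

lemma aux_1d (L : ℝ) (hL : 0 < L) (V D : ℝ → ℝ) (hD : Continuous D)
    (hVD : ∀ x, HasDerivAt V (D x) x) (hodd : ∀ x, V (-x) = - V x)
    (heven : ∀ x, D (-x) = D x) (hVL : V L = 0)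
    (horth : ∫ y in (0:ℝ)..L, V y * Real.sin (π * y / L) = 0) :
    (2 * π / L) ^ 2 * ∫ y in (0:ℝ)..L, V y ^ 2 ≤ ∫ y in (0:ℝ)..L, D y ^ 2 := by
  have hab : -L < L := by linarith
  have hV : Continuous V := continuous_iff_continuousAt.2 fun x => (hVD x).continuousAt
  have mem : ∀ f : ℝ → ℝ, Continuous f →
      MemLp (fun x => (f x : ℂ)) 2 (volume.restrict (Ioc (-L) L)) := by
    intro f hf
    have : ContinuousOn (fun x => (f x : ℂ)) (Icc (-L) L) := by fun_prop
    obtain ⟨C, hC⟩ := isCompact_Icc.exists_bound_of_continuousOn this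
    refine MemLp.of_bound (Continuous.aestronglyMeasurable (by fun_prop)) C ?_
    filter_upwards [ae_restrict_mem measurableSet_Ioc] with x hx
    exact hC x (Ioc_subset_Icc_self hx)
  have hsV := hasSum_sq_fourierCoeffOn hab (mem V hV)
  have hsD := hasSum_sq_fourierCoeffOn hab (mem D hD)
  have hle := hasSum_le (fun n => ?_) (hsV.mul_left ((2 * π / L) ^ 2)) hsD
  · have c1 : ∀ f : ℝ → ℝ, Continuous f → (∀ x, f (-x) ^ 2 = f x ^ 2) →
        ∫ x in (-L)..L, ‖(f x : ℂ)‖ ^ 2 = 2 * ∫ x in (0:ℝ)..L, f x ^ 2 := by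
      intro f hf h2
      simp only [Complex.norm_real, Real.norm_eq_abs, sq_abs]
      rw [aux_split _ (by fun_prop), ← intervalIntegral.integral_const_mul]
      congr 1; ext x; rw [h2]; ring
    rw [c1 V hV (by intro x; rw [hodd]; ring), c1 D hD (by intro x; rw [heven])] at hle
    simp only [smul_eq_mul] at hle
    have h2 : (0:ℝ) < (L - -L)⁻¹ := by apply inv_pos.2; linarith
    have h3 : (L - -L)⁻¹ * 2 * ((2 * π / L) ^ 2 * ∫ y in (0:ℝ)..L, V y ^ 2) ≤
      (L - -L)⁻¹ * 2 * ∫ y in (0:ℝ)..L, D y ^ 2 := by linarith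
    exact le_of_mul_le_mul_left h3 (by positivity)
  · by_cases hn : n = 0 ∨ n = 1 ∨ n = -1
    · rw [aux_coeff_zero L hL hab V hV hodd horth n hn]
      simp
    · have hn0 : n ≠ 0 := by tauto
      have hd := fourierCoeffOn_of_hasDerivAt hab (f := fun x => (V x : ℂ))
        (f' := fun x => (D x : ℂ)) hn0 (fun x _ => (hVD x).ofReal_comp)
        (Continuous.intervalIntegrable (by fun_prop) _ _)
      rw [hd, hodd, hVL]
      have h4 : (2:ℝ) ≤ |(n:ℝ)| := by
        have : (2:ℤ) ≤ |n| := by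
          rcases abs_cases n with h | h <;> omega
        exact_mod_cast this
      simp only [neg_zero, Complex.ofReal_zero, sub_self, mul_zero, zero_sub, norm_mul, norm_neg,
        norm_div, norm_one, Complex.norm_I, mul_one, mul_pow]
      have e1 : ‖((L:ℂ) - ((-L : ℝ) : ℂ))‖ = 2 * L := by
        rw [← Complex.ofReal_sub, Complex.norm_real, Real.norm_eq_abs, abs_of_pos] <;> linarith
      have e2 : ‖(n:ℂ)‖ = |(n:ℝ)| := by simp
      have e3 : ‖(π:ℂ)‖ = π := by simp [abs_of_pos pi_pos]
      rw [e1, e2, e3]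
      simp only [Complex.norm_ofNat]
      rw [← mul_assoc, ← mul_assoc]
      apply mul_le_of_le_one_left (by positivity)
      have : 0 < π := pi_pos
      have e : (2 * π / L) ^ 2 * (1 / (2 * π * |(n:ℝ)|)) ^ 2 * (2 * L) ^ 2 = (2 / |(n:ℝ)|)^2 := by
        have : |(n:ℝ)| ≠ 0 := by positivity
        field_simp
      rw [e]
      apply pow_le_one₀ (by positivity)
      rw [div_le_one (by linarith)]; exact h4

lemma aux_wirt (L : ℝ) (hL : 0 < L) (u : ℝ → ℝ) (hu : ContDiffOn ℝ 1 u (Icc 0 L))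
    (h0 : u 0 = 0) (h1 : u L = 0)
    (horth : ∫ y in (0:ℝ)..L, u y * Real.sin (π * y / L) = 0) :
    (2 * π / L) ^ 2 * ∫ y in (0:ℝ)..L, u y ^ 2 ≤ ∫ y in (0:ℝ)..L, (deriv u y) ^ 2 := by
  have hcd := hu.continuousOn_derivWithin (uniqueDiffOn_Icc hL) le_rfl
  set d := IccExtend hL.le ((Icc 0 L).domRestrict (derivWithin u (Icc 0 L))) with hd
  have hdc : Continuous d := hcd.domRestrict.Icc_extend'
  let D : ℝ → ℝ := fun y => d |y|
  have hD : Continuous D := hdc.comp continuous_abs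
  have heven : ∀ x, D (-x) = D x := fun x => by simp [D]
  let V : ℝ → ℝ := fun y => ∫ t in (0:ℝ)..y, D t
  have hVD : ∀ x, HasDerivAt V (D x) x := fun x => hD.integral_hasStrictDerivAt 0 x |>.hasDerivAt
  have hodd : ∀ x, V (-x) = - V x := by
    intro x
    have := intervalIntegral.integral_comp_neg (a := 0) (b := x) D
    simp only [heven, neg_zero] at this
    simp only [V]
    rw [this, ← intervalIntegral.integral_symm]
  have hder : ∀ y ∈ Ioo 0 L, HasDerivAt u (D y) y := by
    intro y hy
    have h2 : D y = derivWithin u (Icc 0 L) y := by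
      simp only [D, abs_of_pos hy.1, hd]
      rw [IccExtend_of_mem _ _ (Ioo_subset_Icc_self hy)]; rfl
    rw [h2]
    exact ((hu.differentiableOn one_ne_zero) y (Ioo_subset_Icc_self hy)).hasDerivWithinAt.hasDerivAt
      (Icc_mem_nhds hy.1 hy.2)
  have hVu : ∀ y ∈ Icc 0 L, V y = u y := by
    intro y hy
    have := intervalIntegral.integral_eq_sub_of_hasDerivAt_of_le (a := 0) (b := y) (f := u) (f' := D) hy.1
      (hu.continuousOn.mono (Icc_subset_Icc le_rfl hy.2))
      (fun x hx => hder x ⟨hx.1, hx.2.trans_le hy.2⟩) (hD.intervalIntegrable _ _)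
    simp only [V]; rw [this, h0, sub_zero]
  have hi1 : ∫ y in (0:ℝ)..L, u y ^ 2 = ∫ y in (0:ℝ)..L, V y ^ 2 := by
    apply intervalIntegral.integral_congr
    intro y hy; rw [uIcc_of_le hL.le] at hy; simp only [hVu y hy]
  have hi2 : ∫ y in (0:ℝ)..L, u y * Real.sin (π * y / L) = ∫ y in (0:ℝ)..L, V y * Real.sin (π * y / L) := by
    apply intervalIntegral.integral_congr
    intro y hy; rw [uIcc_of_le hL.le] at hy; simp only [hVu y hy]
  have hi3 : ∫ y in (0:ℝ)..L, (deriv u y) ^ 2 = ∫ y in (0:ℝ)..L, D y ^ 2 := by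
    rw [intervalIntegral.integral_of_le hL.le, intervalIntegral.integral_of_le hL.le,
      integral_Ioc_eq_integral_Ioo, integral_Ioc_eq_integral_Ioo]
    apply setIntegral_congr_fun measurableSet_Ioo
    intro y hy; simp only [(hder y hy).deriv]
  rw [hi1, hi3]
  exact aux_1d L hL V D hD hVD hodd heven (by rw [hVu L ⟨hL.le, le_rfl⟩, h1]) (hi2 ▸ horth)

lemma aux_fderiv_bdd (K O : Set (ℝ × ℝ)) (hK : IsCompact K) (hO : IsOpen O) (hOK : O ⊆ K)
    (U : ℝ × ℝ → ℝ) (hU : ContDiffOn ℝ 1 U K) :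
    ∃ C, ∀ q ∈ O, ‖fderiv ℝ U q‖ ≤ C := by
  have : ∃ C, ∀ q ∈ K ∩ O, ‖fderiv ℝ U q‖ ≤ C := by
    refine hK.induction_on (p := fun s => ∃ C, ∀ q ∈ s ∩ O, ‖fderiv ℝ U q‖ ≤ C) ?_ ?_ ?_ ?_
    · exact ⟨0, by simp⟩
    · rintro s t hst ⟨C, hC⟩
      exact ⟨C, fun q hq => hC q ⟨hst hq.1, hq.2⟩⟩
    · rintro s t ⟨C, hC⟩ ⟨C', hC'⟩
      refine ⟨max C C', fun q hq => ?_⟩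
      rcases hq with ⟨hq | hq, hqO⟩
      · exact (hC q ⟨hq, hqO⟩).trans (le_max_left _ _)
      · exact (hC' q ⟨hq, hqO⟩).trans (le_max_right _ _)
    · intro p hp
      have h1 : ContDiffWithinAt ℝ (0 + 1) U K p := by simpa using hU p hp
      rw [contDiffWithinAt_succ_iff_hasFDerivWithinAt (by simp)] at h1
      obtain ⟨u, hu, -, f', hf', hc⟩ := h1
      rw [insert_eq_of_mem hp] at hu
      obtain ⟨W, hW, hpW, hWu⟩ := mem_nhdsWithin.1 hu
      have hcont : ContinuousWithinAt f' u p := hc.continuousWithinAt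
      have hb : ∀ᶠ q in nhdsWithin p u, ‖f' q‖ < ‖f' p‖ + 1 :=
        hcont.norm.eventually (gt_mem_nhds (lt_add_one _))
      obtain ⟨W', hW', hpW', hWu'⟩ := mem_nhdsWithin.1 hb
      refine ⟨W ∩ W' ∩ K, ?_, ‖f' p‖ + 1, ?_⟩
      · exact mem_nhdsWithin.2 ⟨W ∩ W', hW.inter hW', ⟨hpW, hpW'⟩, le_rfl⟩
      · rintro q ⟨⟨⟨hqW, hqW'⟩, hqK⟩, hqO⟩
        have hqu : q ∈ u := hWu ⟨hqW, hqK⟩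
        have hnh : u ∈ nhds q := by
          refine Filter.mem_of_superset ((hW.inter hO).mem_nhds ⟨hqW, hqO⟩) ?_
          exact fun z hz => hWu ⟨hz.1, hOK hz.2⟩
        rw [((hf' q hqu).hasFDerivAt hnh).fderiv]
        exact (hWu' ⟨hqW', hqu⟩ : ‖f' q‖ < _).le
  obtain ⟨C, hC⟩ := this
  exact ⟨C, fun q hq => hC q ⟨hOK hq, hq⟩⟩

lemma aux_region (a b G : ℝ) (hab : -a < b) (g : ℝ → ℝ) (hg : Continuous g)
    (hgpos : ∀ x ∈ Icc (-a) b, 0 < g x) (hgG : ∀ x ∈ Icc (-a) b, g x ≤ G)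
    (U : ℝ × ℝ → ℝ) (Ω : Set (ℝ × ℝ))
    (hΩ : Ω = {p : ℝ × ℝ | p.1 ∈ Icc (-a) b ∧ 0 < p.2 ∧ p.2 < g p.1})
    (hU : ContDiffOn ℝ 1 U (closure Ω)) (hUbd : ∀ p ∈ frontier Ω, U p = 0)
    (horth : ∀ᵐ x : ℝ, x ∈ Icc (-a) b →
      ∫ y in (0:ℝ)..(g x), U (x, y) * Real.sin (π * y / (g x)) = 0) :
    IntegrableOn (fun p => U p ^ 2) Ω ∧ IntegrableOn (gradSq U) Ω ∧
    (2 * π / G) ^ 2 * ∫ p in Ω, U p ^ 2 ≤ ∫ p in Ω, gradSq U p := by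
  have hΩm : MeasurableSet Ω := by
    have := measurableSet_regionBetween (f := fun _ : ℝ => (0:ℝ)) (g := g) measurable_const
      hg.measurable (measurableSet_Icc (a := -a) (b := b))
    rw [hΩ]; exact this
  have hsub : Ω ⊆ Icc (-a) b ×ˢ Icc 0 G := by
    rw [hΩ]; rintro p ⟨h1, h2, h3⟩
    exact ⟨h1, h2.le, h3.le.trans (hgG _ h1)⟩
  have hcomp : IsCompact (closure Ω) :=
    (isCompact_Icc.prod isCompact_Icc).closure_of_subset hsub
  have hUint : IntegrableOn (fun p => U p ^ 2) Ω :=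
    ((hU.continuousOn.pow 2).integrableOn_compact hcomp).mono_set subset_closure
  have hfin : volume Ω ≠ ⊤ := ((measure_mono subset_closure).trans_lt hcomp.measure_lt_top).ne
  -- the open part
  set O : Set (ℝ × ℝ) := {p : ℝ × ℝ | p.1 ∈ Ioo (-a) b ∧ 0 < p.2 ∧ p.2 < g p.1} with hOdef
  have hO : IsOpen O := by
    have : O = {p : ℝ × ℝ | -a < p.1} ∩ {p | p.1 < b} ∩ {p | 0 < p.2} ∩ {p | p.2 < g p.1} := by
      ext p; simp [hOdef, and_assoc]
    rw [this]
    exact (((isOpen_lt (by fun_prop) (by fun_prop)).inter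
      (isOpen_lt (by fun_prop) (by fun_prop))).inter
      (isOpen_lt (by fun_prop) (by fun_prop))).inter (isOpen_lt (by fun_prop) (by fun_prop))
  have hOΩ : O ⊆ Ω := by
    rw [hΩ]; exact fun p hp => ⟨Ioo_subset_Icc_self hp.1, hp.2⟩
  have haeI : ∀ᵐ x : ℝ, x ≠ -a ∧ x ≠ b := by
    have h1 : ∀ᵐ x : ℝ, x ≠ -a := by simp [ae_iff]
    have h2 : ∀ᵐ x : ℝ, x ≠ b := by simp [ae_iff]
    filter_upwards [h1, h2] with x hx hy using ⟨hx, hy⟩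
  have hae2 : ∀ᵐ p : ℝ × ℝ, p.1 ≠ -a ∧ p.1 ≠ b :=
    Measure.quasiMeasurePreserving_fst.ae haeI
  have hOae : O =ᵐ[volume] Ω := by
    filter_upwards [hae2] with p hp
    apply propext
    refine ⟨fun h => hOΩ h, fun h => ?_⟩
    have h' : p ∈ Ω := h
    rw [hΩ] at h'
    exact ⟨⟨lt_of_le_of_ne h'.1.1 (Ne.symm hp.1), lt_of_le_of_ne h'.1.2 hp.2⟩, h'.2⟩
  have hUO : ContDiffOn ℝ 1 U O := hU.mono (hOΩ.trans subset_closure)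
  obtain ⟨C, hC⟩ := aux_fderiv_bdd (closure Ω) O hcomp hO (hOΩ.trans subset_closure) U hU
  have hfc : ContinuousOn (fderiv ℝ U) O := hUO.continuousOn_fderiv_of_isOpen hO le_rfl
  have hdiff : ∀ p ∈ O, DifferentiableAt ℝ U p := fun p hp =>
    (hUO.differentiableOn one_ne_zero).differentiableAt (hO.mem_nhds hp)
  have hvint : ∀ v : ℝ × ℝ, IntegrableOn (fun p => (fderiv ℝ U p v) ^ 2) O := by
    intro v
    have hm : ContinuousOn (fun p => (fderiv ℝ U p v) ^ 2) O :=
      (hfc.clm_apply continuousOn_const).pow 2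
    refine IntegrableOn.of_bound ((measure_mono hOΩ).trans_lt hfin.lt_top)
      (hm.aestronglyMeasurable hO.measurableSet) ((C * ‖v‖) ^ 2) ?_
    filter_upwards [ae_restrict_mem hO.measurableSet] with p hp
    rw [norm_pow]
    exact pow_le_pow_left₀ (norm_nonneg _) ((fderiv ℝ U p).le_of_opNorm_le (hC p hp) v) 2
  have hdx : ∀ p ∈ O, deriv (fun s => U (s, p.2)) p.1 = fderiv ℝ U p (1, 0) := by
    intro p hp
    have h1 : HasFDerivAt U (fderiv ℝ U p) (p.1, p.2) := (hdiff p hp).hasFDerivAt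
    exact (h1.comp_hasDerivAt p.1 ((hasDerivAt_id p.1).prodMk (hasDerivAt_const p.1 p.2))).deriv
  have hdy : ∀ p ∈ O, deriv (fun t => U (p.1, t)) p.2 = fderiv ℝ U p (0, 1) := by
    intro p hp
    have h1 : HasFDerivAt U (fderiv ℝ U p) (p.1, p.2) := (hdiff p hp).hasFDerivAt
    exact (h1.comp_hasDerivAt p.2 ((hasDerivAt_const p.2 p.1).prodMk (hasDerivAt_id p.2))).deriv
  have hyO : IntegrableOn (fun p : ℝ × ℝ => (deriv (fun t => U (p.1, t)) p.2) ^ 2) O :=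
    (hvint (0, 1)).congr_fun (fun p hp => by simp only [hdy p hp]) hO.measurableSet
  have hxO : IntegrableOn (fun p : ℝ × ℝ => (deriv (fun t => U (t, p.2)) p.1) ^ 2) O :=
    (hvint (1, 0)).congr_fun (fun p hp => by simp only [hdx p hp]) hO.measurableSet
  have hyI := hyO.congr_set_ae hOae.symm
  have hxI := hxO.congr_set_ae hOae.symm
  have hgI : IntegrableOn (gradSq U) Ω := hxI.add hyI
  refine ⟨hUint, hgI, ?_⟩
  refine le_trans ?_ (setIntegral_mono hyI hgI (fun p => ?_))
  swap
  · simp only [gradSq]; nlinarith [sq_nonneg (deriv (fun s => U (s, p.2)) p.1)]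
  rw [← MeasureTheory.integral_const_mul, ← MeasureTheory.integral_indicator hΩm, ← MeasureTheory.integral_indicator hΩm]
  have hI1 : Integrable (Ω.indicator fun p => (2 * π / G) ^ 2 * U p ^ 2) (volume.prod volume) :=
    (integrable_indicator_iff hΩm).2 (hUint.const_mul _)
  have hI2 : Integrable (Ω.indicator fun p : ℝ × ℝ => (deriv (fun t => U (p.1, t)) p.2) ^ 2)
      (volume.prod volume) :=
    (integrable_indicator_iff hΩm).2 hyI
  rw [Measure.volume_eq_prod, integral_prod _ hI1, integral_prod _ hI2]
  refine integral_mono_ae hI1.integral_prod_left hI2.integral_prod_left ?_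
  filter_upwards [horth] with x hx
  by_cases hxI : x ∈ Icc (-a) b
  swap
  · have : ∀ (F : ℝ × ℝ → ℝ) y, Ω.indicator F (x, y) = 0 := by
      intro F y; apply indicator_of_notMem; rw [hΩ]; exact fun h => hxI h.1
    simp [this]
  have hg0 := hgpos x hxI
  have hfib : ∀ (F : ℝ × ℝ → ℝ), ∫ y, Ω.indicator F (x, y) = ∫ y in (0:ℝ)..(g x), F (x, y) := by
    intro F
    rw [intervalIntegral.integral_of_le hg0.le, integral_Ioc_eq_integral_Ioo,
      ← MeasureTheory.integral_indicator measurableSet_Ioo]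
    congr 1; ext y
    simp only [indicator]
    congr 1
    rw [hΩ]; simp only [mem_ofPred_eq, mem_Ioo, hxI, true_and]
  simp only [hfib]
  have hclos : ∀ y ∈ Icc 0 (g x), (x, y) ∈ closure Ω := by
    intro y hy
    rw [← closure_Ioo hg0.ne] at hy
    have hc : Continuous (fun y : ℝ => (x, y)) := by fun_prop
    refine closure_mono ?_ (image_closure_subset_closure_image hc ⟨y, hy, rfl⟩)
    rintro _ ⟨z, hz, rfl⟩
    rw [hΩ]; exact ⟨hxI, hz.1, hz.2⟩
  have hfr : ∀ y ∈ Icc 0 (g x), y ∉ Ioo 0 (g x) → U (x, y) = 0 := by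
    intro y hy hy'
    refine hUbd _ ⟨hclos y hy, fun hi => hy' ?_⟩
    have := interior_subset hi
    rw [hΩ] at this; exact this.2
  have hw := aux_wirt (g x) hg0 (fun y => U (x, y))
    (hU.comp (by fun_prop) (fun y hy => hclos y hy))
    (hfr 0 ⟨le_rfl, hg0.le⟩ (by simp)) (hfr _ ⟨hg0.le, le_rfl⟩ (by simp)) (hx hxI)
  refine le_trans ?_ hw
  rw [intervalIntegral.integral_const_mul]
  apply mul_le_mul_of_nonneg_right
  · have := pi_pos
    have := hgG x hxI
    gcongr
    exact div_nonneg (by positivity) (hg0.le.trans this)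
  · exact intervalIntegral.integral_nonneg hg0.le (fun y _ => sq_nonneg _)

/-- **Estimate (3.5)** (Friedlander–Solomyak). If `U ∈ C¹(closure Ω_ε)` vanishes on
`∂Ω_ε` and is fiberwise orthogonal to `sin(πy/(εh(x)))`, then
`∫_{Ω_ε} U² ≤ (M²ε²/(3π²)) ∫_{Ω_ε} (|∇U|² − (π²/(M²ε²)) U²)`. -/
theorem orthogonal_complement_quadratic_form_estimate
    (a b : ℝ) (ha : 0 < a) (hb : 0 < b)
    (h : ℝ → ℝ)
    (hcont : ContinuousOn h (Icc (-a) b))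
    (hpos : ∀ x ∈ Icc (-a) b, 0 < h x)
    (hmax : ∀ x ∈ Icc (-a) b, h x ≤ h 0)
    (ε : ℝ) (hε : 0 < ε)
    (U : ℝ × ℝ → ℝ)
    (hU : ContDiffOn ℝ 1 U
      (closure {p : ℝ × ℝ | p.1 ∈ Icc (-a) b ∧ 0 < p.2 ∧ p.2 < ε * h p.1}))
    (hUbd : ∀ p ∈ frontier {p : ℝ × ℝ | p.1 ∈ Icc (-a) b ∧ 0 < p.2 ∧ p.2 < ε * h p.1},
      U p = 0)
    (horth : ∀ᵐ x : ℝ, x ∈ Icc (-a) b →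
      ∫ y in (0:ℝ)..(ε * h x), U (x, y) * Real.sin (π * y / (ε * h x)) = 0) :
    ∫ p in {p : ℝ × ℝ | p.1 ∈ Icc (-a) b ∧ 0 < p.2 ∧ p.2 < ε * h p.1}, U p ^ 2
      ≤ (h 0) ^ 2 * ε ^ 2 / (3 * π ^ 2) *
          ∫ p in {p : ℝ × ℝ | p.1 ∈ Icc (-a) b ∧ 0 < p.2 ∧ p.2 < ε * h p.1},
            (gradSq U p - π ^ 2 / ((h 0) ^ 2 * ε ^ 2) * U p ^ 2) := by
  have hab : -a < b := by linarith
  have h0I : (0:ℝ) ∈ Icc (-a) b := ⟨by linarith, hb.le⟩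
  have h0 := hpos 0 h0I
  set g : ℝ → ℝ := fun x => ε * IccExtend hab.le ((Icc (-a) b).domRestrict h) x with hg
  have hgc : Continuous g := continuous_const.mul hcont.domRestrict.Icc_extend'
  have hgx : ∀ x ∈ Icc (-a) b, g x = ε * h x := by
    intro x hx; simp only [hg]; rw [IccExtend_of_mem _ _ hx]; rfl
  set Ω := {p : ℝ × ℝ | p.1 ∈ Icc (-a) b ∧ 0 < p.2 ∧ p.2 < ε * h p.1} with hΩ
  have hΩ' : Ω = {p : ℝ × ℝ | p.1 ∈ Icc (-a) b ∧ 0 < p.2 ∧ p.2 < g p.1} := by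
    ext p
    simp only [hΩ, mem_ofPred_eq]
    refine and_congr_right fun hp => ?_
    rw [hgx _ hp]
  obtain ⟨i1, i2, hle⟩ := aux_region a b (ε * h 0) hab g hgc
    (fun x hx => by rw [hgx x hx]; exact mul_pos hε (hpos x hx))
    (fun x hx => by rw [hgx x hx]; exact mul_le_mul_of_nonneg_left (hmax x hx) hε.le)
    U Ω hΩ' hU hUbd (by
      filter_upwards [horth] with x hx hxI
      rw [hgx x hxI]; exact hx hxI)
  rw [integral_sub i2 (i1.const_mul _), MeasureTheory.integral_const_mul]
  have hpi := pi_pos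
  set A := ∫ p in Ω, U p ^ 2
  set B := ∫ p in Ω, gradSq U p
  have e : A = h 0 ^ 2 * ε ^ 2 / (3 * π ^ 2) *
      ((2 * π / (ε * h 0)) ^ 2 * A - π ^ 2 / (h 0 ^ 2 * ε ^ 2) * A) := by
    field_simp; ring
  calc A = _ := e
    _ ≤ _ := by gcongr
end

section
/- There is a constant C' > 0, independent of ε, such that for every ε > 0, every χ ∈ C_c^∞((-a,b)) and every C¹ function U on the closure of Ω_ε vanishing on ∂Ω_ε and satisfying ∫₀^{ε h(x)} U(x,y) sin(π y/(ε h(x))) dy = 0 for a.e. x ∈ I, one has | ∫_{Ω_ε} ∂_x ψ_χ · ∂_x U dx dy | ≤ C' ε^α [ ∫_I ( χ'² + W_ε χ² ) dx + ∫_{Ω_ε} ( |∇U|² − (π²/(M² ε²)) U² ) dx dy ]. -/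
open MeasureTheory Real Set intervalIntegral

lemma aux_lip (L : ℝ) (u u' : ℝ → ℝ) (K : ℝ)
    (hc : ContinuousOn u (Icc 0 L)) (hd : ∀ y ∈ Ioo 0 L, HasDerivAt u (u' y) y)
    (hb : ∀ y ∈ Ioo 0 L, |u' y| ≤ K) (s t : ℝ) (hs : 0 ≤ s) (hst : s < t) (ht : t ≤ L) :
    |u t - u s| ≤ K * (t - s) := by
  obtain ⟨z, hz, hz'⟩ := exists_hasDerivAt_eq_slope u u' hst
    (hc.mono (Icc_subset_Icc hs ht)) (fun x hx => hd x ⟨by linarith [hx.1], by linarith [hx.2]⟩)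
  have h1 := hb z ⟨by linarith [hz.1], by linarith [hz.2]⟩
  have h2 : u t - u s = u' z * (t - s) := by
    rw [hz']; field_simp [(sub_pos.2 hst).ne']
  rw [h2, abs_mul, abs_of_pos (sub_pos.2 hst)]
  exact mul_le_mul_of_nonneg_right h1 (sub_pos.2 hst).le

lemma aux_sin_lower (L : ℝ) (hL : 0 < L) (y : ℝ) (h0 : 0 ≤ y) (h1 : y ≤ L) :
    2 / L * min y (L - y) ≤ Real.sin (π * y / L) := by
  have hpi := Real.pi_pos
  rcases le_total y (L / 2) with hy | hy
  · have := Real.mul_le_sin (x := π * y / L) (by positivity) (by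
      rw [div_le_div_iff₀ hL (by norm_num)]; nlinarith)
    have e : 2 / π * (π * y / L) = 2 / L * y := by field_simp
    rw [e] at this
    refine le_trans ?_ this
    gcongr
    exact min_le_left _ _
  · have := Real.mul_le_sin (x := π * (L - y) / L)
      (div_nonneg (mul_nonneg hpi.le (by linarith)) hL.le) (by
      rw [div_le_div_iff₀ hL (by norm_num)]; nlinarith)
    have e : 2 / π * (π * (L - y) / L) = 2 / L * (L - y) := by field_simp
    have e2 : π * (L - y) / L = π - π * y / L := by field_simp
    rw [e, e2, Real.sin_pi_sub] at this
    refine le_trans ?_ this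
    gcongr
    exact min_le_right _ _

lemma aux_T_bound (c S u F w K L d : ℝ) (hL : 0 < L) (hd : 0 < d) (hdL : d ≤ L) (hw : 0 < w)
    (hK : 0 ≤ K)
    (hc : |c| ≤ 1) (hS : 2 / L * d ≤ S) (hu : |u| ≤ K * d) (hF : |F| ≤ K * d ^ 2) :
    |c / S * u ^ 2 - 6 * w * F * u / S + 9 * c * w ^ 2 * F ^ 2 / S ^ 3| ≤
      (K ^ 2 * L / 2 + 3 * w * K ^ 2 * L ^ 2 + 9 * w ^ 2 * K ^ 2 * L ^ 3 / 8) * d := by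
  have h2 : 0 < 2 / L * d := by positivity
  have hSp : 0 < S := lt_of_lt_of_le h2 hS
  have hi : 1 / S ≤ L / (2 * d) := by
    rw [div_le_div_iff₀ hSp (by positivity)]
    have : 2 / L * d * L ≤ S * L := by gcongr
    have e : 2 / L * d * L = 2 * d := by field_simp
    linarith
  have hip : 0 < 1 / S := by positivity
  have b1 : |c / S * u ^ 2| ≤ K ^ 2 * L / 2 * d := by
    have : |c / S * u ^ 2| = |c| * (1 / S) * |u| ^ 2 := by
      rw [abs_mul, abs_div, abs_of_pos hSp, abs_pow]; ring
    rw [this]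
    calc _ ≤ 1 * (L / (2 * d)) * (K * d) ^ 2 := by gcongr
      _ = _ := by field_simp
  have b2 : |6 * w * F * u / S| ≤ 3 * w * K ^ 2 * L ^ 2 * d := by
    have : |6 * w * F * u / S| = 6 * w * |F| * |u| * (1 / S) := by
      rw [abs_div, abs_mul, abs_mul, abs_of_pos hSp, abs_of_pos (by positivity : 0 < 6 * w)]; ring
    rw [this]
    calc _ ≤ 6 * w * (K * d ^ 2) * (K * d) * (L / (2 * d)) := by gcongr
      _ = 3 * w * K ^ 2 * L * d * d := by field_simp; ring
      _ ≤ 3 * w * K ^ 2 * L * L * d := by gcongr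
      _ = _ := by ring
  have b3 : |9 * c * w ^ 2 * F ^ 2 / S ^ 3| ≤ 9 * w ^ 2 * K ^ 2 * L ^ 3 / 8 * d := by
    have : |9 * c * w ^ 2 * F ^ 2 / S ^ 3| = 9 * |c| * w ^ 2 * |F| ^ 2 * (1 / S) ^ 3 := by
      rw [abs_div, abs_mul, abs_mul, abs_mul, abs_of_pos (pow_pos hSp 3), abs_pow, abs_pow,
        abs_of_pos hw, abs_of_pos (by norm_num : (0:ℝ) < 9)]; field_simp
    rw [this]
    calc _ ≤ 9 * 1 * w ^ 2 * (K * d ^ 2) ^ 2 * (L / (2 * d)) ^ 3 := by gcongr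
      _ = _ := by field_simp; ring
  calc _ ≤ |c / S * u ^ 2| + |6 * w * F * u / S| + |9 * c * w ^ 2 * F ^ 2 / S ^ 3| := by
        refine (abs_add_le _ _).trans ?_
        gcongr
        exact abs_sub _ _
    _ ≤ _ := by nlinarith

lemma poincare_sin (L : ℝ) (hL : 0 < L) (u u' : ℝ → ℝ) (K : ℝ)
    (hc : ContinuousOn u (Icc 0 L)) (hd : ∀ y ∈ Ioo 0 L, HasDerivAt u (u' y) y)
    (hb : ∀ y ∈ Ioo 0 L, |u' y| ≤ K) (hu0 : u 0 = 0) (huL : u L = 0)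
    (hint : IntervalIntegrable (fun y => u' y ^ 2) volume 0 L)
    (horth : ∫ y in (0:ℝ)..L, u y * Real.sin (π * y / L) = 0) :
    4 * π ^ 2 / L ^ 2 * (∫ y in (0:ℝ)..L, u y ^ 2) ≤ ∫ y in (0:ℝ)..L, u' y ^ 2 := by
  have hpi := Real.pi_pos
  have hK : 0 ≤ K := (abs_nonneg _).trans (hb (L / 2) ⟨by linarith, by linarith⟩)
  set w : ℝ := π / L with hw
  have hwp : 0 < w := by positivity
  have hcs : ContinuousOn (fun y => u y * Real.sin (π * y / L)) (Icc 0 L) :=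
    hc.mul (by fun_prop)
  set F : ℝ → ℝ := fun y => ∫ s in (0:ℝ)..y, u s * Real.sin (π * s / L) with hF
  have hub1 : ∀ y ∈ Icc 0 L, |u y| ≤ K * y := by
    intro y hy
    rcases eq_or_lt_of_le hy.1 with h | h
    · rw [← h, hu0]; simp
    · simpa [hu0] using aux_lip L u u' K hc hd hb 0 y le_rfl h hy.2
  have hub2 : ∀ y ∈ Icc 0 L, |u y| ≤ K * (L - y) := by
    intro y hy
    rcases eq_or_lt_of_le hy.2 with h | h
    · rw [h, huL]; simp
    · simpa [huL] using aux_lip L u u' K hc hd hb y L hy.1 h le_rfl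
  have hii : ∀ s t, 0 ≤ s → s ≤ t → t ≤ L →
      IntervalIntegrable (fun y => u y * Real.sin (π * y / L)) volume s t := by
    intro s t hs hst ht
    refine ContinuousOn.intervalIntegrable_of_Icc hst (hcs.mono (Icc_subset_Icc hs ht))
  have hFb1 : ∀ y ∈ Icc 0 L, |F y| ≤ K * y ^ 2 := by
    intro y hy
    have := intervalIntegral.norm_integral_le_of_norm_le_const (a := 0) (b := y) (C := K * y)
      (f := fun s => u s * Real.sin (π * s / L)) (by
        intro s hs
        rw [uIoc_of_le hy.1] at hs
        rw [Real.norm_eq_abs, abs_mul]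
        have h1 := hub1 s ⟨hs.1.le, hs.2.trans hy.2⟩
        have h2 := Real.abs_sin_le_one (π * s / L)
        calc |u s| * |Real.sin (π * s / L)| ≤ |u s| * 1 := by gcongr
          _ ≤ K * y := by rw [mul_one]; exact h1.trans (by gcongr; exact hs.2))
    rw [Real.norm_eq_abs, sub_zero, abs_of_nonneg hy.1] at this
    calc _ ≤ _ := this
      _ = _ := by ring
  have hFb2 : ∀ y ∈ Icc 0 L, |F y| ≤ K * (L - y) ^ 2 := by
    intro y hy
    have := intervalIntegral.norm_integral_le_of_norm_le_const (a := y) (b := L) (C := K * (L - y))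
      (f := fun s => u s * Real.sin (π * s / L)) (by
        intro s hs
        rw [uIoc_of_le hy.2] at hs
        rw [Real.norm_eq_abs, abs_mul]
        have h1 := hub2 s ⟨hy.1.trans hs.1.le, hs.2⟩
        have h2 := Real.abs_sin_le_one (π * s / L)
        calc |u s| * |Real.sin (π * s / L)| ≤ |u s| * 1 := by gcongr
          _ ≤ K * (L - y) := by rw [mul_one]; exact h1.trans (by gcongr; exact hs.1.le))
    have hadd := intervalIntegral.integral_add_adjacent_intervals
      (hii 0 y le_rfl hy.1 hy.2) (hii y L hy.1 hy.2 le_rfl)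
    rw [horth] at hadd
    have e : F y = - ∫ s in y..L, u s * Real.sin (π * s / L) := by
      simp only [hF]; linarith
    rw [Real.norm_eq_abs, abs_of_nonneg (sub_nonneg.2 hy.2)] at this
    rw [e, abs_neg]
    calc _ ≤ _ := this
      _ = _ := by ring
  have hFd : ∀ y ∈ Ioo 0 L, HasDerivAt F (u y * Real.sin (π * y / L)) y := by
    intro y hy
    refine intervalIntegral.integral_hasDerivAt_right (hii 0 y le_rfl hy.1.le hy.2.le) ?_ ?_
    · exact ContinuousOn.stronglyMeasurableAtFilter isOpen_Ioo (hcs.mono Ioo_subset_Icc_self) y hy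
    · exact (hcs y (Ioo_subset_Icc_self hy)).continuousAt (Icc_mem_nhds hy.1 hy.2)
  have hSpos : ∀ y ∈ Ioo 0 L, 0 < Real.sin (π * y / L) := by
    intro y hy
    apply Real.sin_pos_of_pos_of_lt_pi
    · have := hy.1; positivity
    · rw [div_lt_iff₀ hL]; exact mul_lt_mul_of_pos_left hy.2 hpi
  set T : ℝ → ℝ := fun y => Real.cos (π * y / L) / Real.sin (π * y / L) * u y ^ 2
    - 6 * w * F y * u y / Real.sin (π * y / L)
    + 9 * Real.cos (π * y / L) * w ^ 2 * F y ^ 2 / Real.sin (π * y / L) ^ 3 with hT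
  have hTd : ∀ y ∈ Ioo 0 L, ∃ T', HasDerivAt T T' y ∧ T' ≤ u' y ^ 2 / w - 4 * w * u y ^ 2 := by
    intro y hy
    have hS := hSpos y hy
    have d0 : HasDerivAt (fun y => π * y / L) w y := by
      have := ((hasDerivAt_id y).const_mul π).div_const L
      simpa [hw] using this
    have dS := d0.sin
    have dC := d0.cos
    have dF := hFd y hy
    have du := hd y hy
    have D := (((dC.div dS hS.ne').mul (du.pow 2)).sub
      ((((dF.const_mul (6 * w)).mul du)).div dS hS.ne')).add
      ((((dC.const_mul 9).mul_const (w ^ 2)).mul (dF.pow 2)).div (dS.pow 3) (pow_pos hS 3).ne')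
    refine ⟨_, D, ?_⟩
    have hsc := Real.sin_sq_add_cos_sq (π * y / L)
    dsimp only [Pi.pow_apply, Pi.mul_apply, Pi.div_apply]
    generalize Real.sin (π * y / L) = S at *
    generalize Real.cos (π * y / L) = c at *
    generalize u y = v at *
    generalize u' y = v' at *
    generalize F y = G at *
    have hpos : 0 ≤ (w * ((v' / w - c / S * v + 3 * w * G / S) ^ 2 +
       3 * (v - 3 * c * w * G / S ^ 2) ^ 2)) := by positivity
    refine le_of_sub_nonneg (le_of_le_of_eq hpos ?_)
    have hc2 : c ^ 2 = 1 - S ^ 2 := by linarith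
    clear_value w
    field_simp
    ring_nf
  choose! T' hT' using hTd
  have hTends : T 0 = 0 ∧ T L = 0 := by
    constructor
    · simp [hT]
    · have : π * L / L = π := by field_simp
      simp [hT, this]
  set C := (K ^ 2 * L / 2 + 3 * w * K ^ 2 * L ^ 2 + 9 * w ^ 2 * K ^ 2 * L ^ 3 / 8)
  have hTb : ∀ y ∈ Icc 0 L, |T y| ≤ C * min y (L - y) := by
    intro y hy
    rcases eq_or_lt_of_le hy.1 with h | h
    · rw [← h, hTends.1]; simp [hL.le]
    rcases eq_or_lt_of_le hy.2 with h' | h'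
    · rw [h', hTends.2]; simp [hL.le]
    refine aux_T_bound _ _ _ _ w K L _ hL (lt_min h (by linarith)) ((min_le_left _ _).trans hy.2)
      hwp hK (Real.abs_cos_le_one _) (aux_sin_lower L hL y hy.1 hy.2) ?_ ?_
    · rcases min_choice y (L - y) with e | e <;> rw [e]
      exacts [hub1 y hy, hub2 y hy]
    · rcases min_choice y (L - y) with e | e <;> rw [e]
      exacts [hFb1 y hy, hFb2 y hy]
  have hTc : ContinuousOn T (Icc 0 L) := by
    have hcont0 : ∀ y ∈ Icc 0 L, T y = 0 → min y (L - y) = 0 → ContinuousWithinAt T (Icc 0 L) y := by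
      intro y hy h0 hm
      rw [ContinuousWithinAt, h0]
      refine squeeze_zero_norm' (a := fun y => C * min y (L - y)) ?_ ?_
      · filter_upwards [self_mem_nhdsWithin] with z hz using hTb z hz
      · have : Continuous (fun y : ℝ => C * min y (L - y)) := by fun_prop
        have h2 := this.continuousWithinAt (s := Icc 0 L) (x := y)
        rw [ContinuousWithinAt, hm, mul_zero] at h2
        exact h2
    intro y hy
    rcases eq_or_lt_of_le hy.1 with h | h
    · exact hcont0 y hy (h ▸ hTends.1) (by rw [← h]; simp [hL.le])
    rcases eq_or_lt_of_le hy.2 with h' | h'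
    · exact hcont0 y hy (h'.symm ▸ hTends.2) (by rw [h']; simp [hL.le])
    · exact (hT' y ⟨h, h'⟩).1.continuousAt.continuousWithinAt
  have hu2 : IntervalIntegrable (fun y => u y ^ 2) volume 0 L :=
    ContinuousOn.intervalIntegrable_of_Icc hL.le (hc.pow 2)
  have hφ : IntervalIntegrable (fun y => u' y ^ 2 / w - 4 * w * u y ^ 2) volume 0 L :=
    (hint.div_const w).sub (hu2.const_mul (4 * w))
  have := intervalIntegral.sub_le_integral_of_hasDeriv_right_of_le hL.le hTc
    (fun y hy => (hT' y hy).1.hasDerivWithinAt)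
    ((intervalIntegrable_iff_integrableOn_Icc_of_le hL.le).1 hφ) (fun y hy => (hT' y hy).2)
  rw [hTends.1, hTends.2, intervalIntegral.integral_sub (hint.div_const w) (hu2.const_mul (4 * w)),
    intervalIntegral.integral_div, intervalIntegral.integral_const_mul] at this
  have e : 4 * π ^ 2 / L ^ 2 = 4 * w ^ 2 := by rw [hw]; ring
  rw [e]
  set A := ∫ y in (0:ℝ)..L, u' y ^ 2
  have h3 : 4 * w * (∫ y in (0:ℝ)..L, u y ^ 2) ≤ A / w := by linarith
  rw [le_div_iff₀ hwp] at h3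
  linarith


lemma osc_point (m δ x X Y : ℝ) (hm : 1 ≤ m) (hδ : 0 < δ) :
    X ^ 2 / 2 ≤ ((1 - (x / δ) ^ 2) / (1 + (x / δ) ^ 2) ^ 2 * X ^ 2
      + x / (1 + (x / δ) ^ 2) * (2 * X * Y)) + δ ^ 2 * Y ^ 2
      + 2 * 4 ^ m * (δ ^ m)⁻¹ * (|x| ^ m * X ^ 2) := by
  set t := x / δ with ht
  have hx : x = δ * t := by rw [ht]; field_simp
  have h4 : (0:ℝ) < 1 + t ^ 2 := by positivity
  have hT : 1 - (1 - t ^ 2) / (1 + t ^ 2) ^ 2 ≤ 1 / 4 + 2 * 4 ^ m * |t| ^ m := by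
    rcases le_total (|t|) (1 / 4) with h | h
    · have h1 : t ^ 2 ≤ 1 / 16 := by
        rw [← sq_abs]; nlinarith [abs_nonneg t]
      have h2 : 0 ≤ 2 * (4:ℝ) ^ m * |t| ^ m := by positivity
      have h3 : 3 / 4 ≤ (1 - t ^ 2) / (1 + t ^ 2) ^ 2 := by
        rw [le_div_iff₀ (by positivity)]; nlinarith [sq_nonneg t]
      linarith
    · have h1 : (1:ℝ) ≤ 4 ^ m * |t| ^ m := by
        rw [← Real.mul_rpow (by norm_num) (abs_nonneg _)]
        exact Real.one_le_rpow (by linarith) (by linarith)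
      have h3 : -1 ≤ (1 - t ^ 2) / (1 + t ^ 2) ^ 2 := by
        rw [le_div_iff₀ (by positivity)]; nlinarith [sq_nonneg t]
      nlinarith
  have e1 : (δ ^ m)⁻¹ * |x| ^ m = |t| ^ m := by
    rw [ht, abs_div, abs_of_pos hδ, Real.div_rpow (abs_nonneg _) hδ.le]; field_simp
  have e2 : 2 * 4 ^ m * (δ ^ m)⁻¹ * (|x| ^ m * X ^ 2) = 2 * 4 ^ m * |t| ^ m * X ^ 2 := by
    rw [← e1]; ring
  rw [e2]
  have hw : |t / (1 + t ^ 2)| ≤ 1 / 2 := by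
    rw [abs_div, abs_of_pos h4, div_le_div_iff₀ h4 (by norm_num), ← sq_abs]
    nlinarith [sq_nonneg (|t| - 1)]
  have hcross : - (X ^ 2 / 4 + δ ^ 2 * Y ^ 2) ≤ x / (1 + t ^ 2) * (2 * X * Y) := by
    have e3 : x / (1 + t ^ 2) * (2 * X * Y) = 2 * (t / (1 + t ^ 2)) * (X * (δ * Y)) := by
      rw [hx]; ring
    rw [e3]
    set r := t / (1 + t ^ 2)
    have hr := abs_le.1 hw
    have hr2 : r ^ 2 ≤ 1 / 4 := by nlinarith
    nlinarith [sq_nonneg (r * X * 1 + δ * Y), sq_nonneg X]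
  have := mul_le_mul_of_nonneg_right hT (sq_nonneg X)
  nlinarith

lemma osc (a b m δ : ℝ) (hab : -a ≤ b) (hm : 1 ≤ m) (hδ : 0 < δ) (χ χ' : ℝ → ℝ)
    (hd : ∀ x, HasDerivAt χ (χ' x) x) (hc : Continuous χ')
    (h1 : χ (-a) = 0) (h2 : χ b = 0) :
    (∫ x in (-a)..b, χ x ^ 2) / 2 ≤ ∫ x in (-a)..b, (δ ^ 2 * χ' x ^ 2
      + 2 * 4 ^ m * (δ ^ m)⁻¹ * (|x| ^ m * χ x ^ 2)) := by
  have hχ : Continuous χ := continuous_iff_continuousAt.2 fun x => (hd x).continuousAt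
  set w : ℝ → ℝ := fun x => x / (1 + (x / δ) ^ 2)
  set w' : ℝ → ℝ := fun x => (1 - (x / δ) ^ 2) / (1 + (x / δ) ^ 2) ^ 2
  have hpos : ∀ x : ℝ, (1 + (x / δ) ^ 2) ≠ 0 := fun x => by positivity
  have hw : ∀ x, HasDerivAt w (w' x) x := by
    intro x
    have := (hasDerivAt_id x).div ((((hasDerivAt_id x).div_const δ).pow 2).const_add 1) (hpos x)
    refine this.congr_deriv ?_
    simp only [w', id]
    congr 1
    simp; ring
  have hw'c : Continuous w' := by
    refine Continuous.div (by fun_prop) (by fun_prop) fun x => by have := hpos x; positivity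
  have hwc : Continuous w := Continuous.div (by fun_prop) (by fun_prop) hpos
  have hG := intervalIntegral.integral_eq_sub_of_hasDerivAt (a := -a) (b := b)
    (f := fun x => w x * χ x ^ 2)
    (f' := fun x => w' x * χ x ^ 2 + w x * (2 * χ x * χ' x))
    (fun x _ => by
      refine ((hw x).mul ((hd x).pow 2)).congr_deriv ?_
      simp) (Continuous.intervalIntegrable (by fun_prop) _ _)
  simp only [h1, h2] at hG
  have hmc : Continuous fun x : ℝ => |x| ^ m :=
    continuous_abs.rpow_const fun x => Or.inr (by linarith)
  have hi2 : IntervalIntegrable (fun x => δ ^ 2 * χ' x ^ 2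
      + 2 * 4 ^ m * (δ ^ m)⁻¹ * (|x| ^ m * χ x ^ 2)) volume (-a) b :=
    Continuous.intervalIntegrable (by fun_prop) _ _
  have hi1 : IntervalIntegrable (fun x => w' x * χ x ^ 2 + w x * (2 * χ x * χ' x)) volume (-a) b :=
    Continuous.intervalIntegrable (by fun_prop) _ _
  have := intervalIntegral.integral_mono_on (μ := volume) hab (f := fun x => χ x ^ 2 / 2)
    (g := fun x => (w' x * χ x ^ 2 + w x * (2 * χ x * χ' x)) + (δ ^ 2 * χ' x ^ 2
      + 2 * 4 ^ m * (δ ^ m)⁻¹ * (|x| ^ m * χ x ^ 2)))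
    (Continuous.intervalIntegrable (by fun_prop) _ _) (hi1.add hi2)
    (fun x _ => by
      have := osc_point m δ x (χ x) (χ' x) hm hδ
      simp only [w, w']; linarith)
  rw [intervalIntegral.integral_add hi1 hi2, intervalIntegral.integral_div, hG] at this
  linarith

lemma poinc_x (a b : ℝ) (ha : 0 < a) (hb : 0 < b) (χ χ' : ℝ → ℝ)
    (hd : ∀ x, HasDerivAt χ (χ' x) x) (hc : Continuous χ')
    (h1 : χ (-a) = 0) (h2 : χ b = 0) :
    (∫ x in (-a)..b, χ x ^ 2) ≤ 4 * (a + b) ^ 2 * ∫ x in (-a)..b, χ' x ^ 2 := by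
  have hχ : Continuous χ := continuous_iff_continuousAt.2 fun x => (hd x).continuousAt
  have hG := intervalIntegral.integral_eq_sub_of_hasDerivAt (a := -a) (b := b)
    (f := fun x => x * χ x ^ 2)
    (f' := fun x => 1 * χ x ^ 2 + x * (2 * χ x * χ' x))
    (fun x _ => by
      refine ((hasDerivAt_id x).mul ((hd x).pow 2)).congr_deriv ?_
      simp) (Continuous.intervalIntegrable (by fun_prop) _ _)
  simp only [h1, h2] at hG
  have hi2 : IntervalIntegrable (fun x => 2 * (a + b) ^ 2 * χ' x ^ 2) volume (-a) b :=
    Continuous.intervalIntegrable (by fun_prop) _ _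
  have hi1 : IntervalIntegrable (fun x => 1 * χ x ^ 2 + x * (2 * χ x * χ' x)) volume (-a) b :=
    Continuous.intervalIntegrable (by fun_prop) _ _
  have := intervalIntegral.integral_mono_on (μ := volume) (by linarith) (f := fun x => χ x ^ 2 / 2)
    (g := fun x => (1 * χ x ^ 2 + x * (2 * χ x * χ' x)) + 2 * (a + b) ^ 2 * χ' x ^ 2)
    (Continuous.intervalIntegrable (by fun_prop) _ _) (hi1.add hi2)
    (fun x hx => by
      have hx2 : x ^ 2 ≤ (a + b) ^ 2 := by
        apply sq_le_sq'
        · linarith [hx.1]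
        · linarith [hx.2]
      have := mul_le_mul_of_nonneg_right hx2 (sq_nonneg (χ' x))

      nlinarith [sq_nonneg (χ x + 2 * x * χ' x)])
  rw [intervalIntegral.integral_add hi1 hi2, intervalIntegral.integral_div, hG,
    intervalIntegral.integral_const_mul] at this
  linarith

lemma g_lower (a b : ℝ) (ha : 0 < a) (hb : 0 < b)
    (h : ℝ → ℝ)
    (hcont : ContinuousOn h (Icc (-a) b))
    (hpos : ∀ x ∈ Icc (-a) b, 0 < h x)
    (hmax : ∀ x ∈ Icc (-a) b, x ≠ 0 → h x < h 0)
    (m cp cm K η : ℝ)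
    (hm : 1 ≤ m) (hcp : 0 < cp) (hcm : 0 < cm) (hK : 0 < K) (hη : 0 < η)
    (hexp_pos : ∀ x : ℝ, 0 < x → x ≤ η →
      |h x - (h 0 - cp * x ^ m)| ≤ K * x ^ (m + 1))
    (hexp_neg : ∀ x : ℝ, -η ≤ x → x < 0 →
      |h x - (h 0 - cm * |x| ^ m)| ≤ K * |x| ^ (m + 1)) :
    ∃ c : ℝ, 0 < c ∧ ∀ x ∈ Icc (-a) b, c * |x| ^ m ≤ ((h x) ^ 2)⁻¹ - ((h 0) ^ 2)⁻¹ := by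
  have h0 : (0:ℝ) ∈ Icc (-a) b := ⟨by linarith, hb.le⟩
  have hM := hpos 0 h0
  set c1 := min cp cm with hc1
  have hc1p : 0 < c1 := lt_min hcp hcm
  set ρ := min η (c1 / (2 * K)) with hρ
  have hρp : 0 < ρ := lt_min hη (by positivity)
  have hKρ : K * ρ ≤ c1 / 2 := by
    have : ρ ≤ c1 / (2 * K) := min_le_right _ _
    calc K * ρ ≤ K * (c1 / (2 * K)) := by gcongr
      _ = _ := by field_simp
  have near : ∀ x : ℝ, x ≠ 0 → |x| ≤ ρ → c1 / 2 * |x| ^ m ≤ h 0 - h x := by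
    intro x hx hxρ
    have hxp : 0 < |x| := abs_pos.2 hx
    have hxm : 0 < |x| ^ m := Real.rpow_pos_of_pos hxp m
    have hxη : |x| ≤ η := hxρ.trans (min_le_left _ _)
    have key : ∃ c, c1 ≤ c ∧ |h x - (h 0 - c * |x| ^ m)| ≤ K * |x| ^ (m + 1) := by
      rcases lt_or_gt_of_ne hx with hl | hg
      · exact ⟨cm, min_le_right _ _, hexp_neg x (by rw [abs_of_neg hl] at hxη; linarith) hl⟩
      · refine ⟨cp, min_le_left _ _, ?_⟩
        rw [abs_of_pos hg] at hxη ⊢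
        exact hexp_pos x hg hxη
    obtain ⟨c, hc, hk⟩ := key
    rw [Real.rpow_add hxp, Real.rpow_one] at hk
    have hk' := (abs_le.1 hk).2
    have h1 : K * (|x| ^ m * |x|) ≤ c1 / 2 * |x| ^ m := by
      calc K * (|x| ^ m * |x|) = K * |x| * |x| ^ m := by ring
        _ ≤ K * ρ * |x| ^ m := by gcongr
        _ ≤ _ := by gcongr
    have h2 : c1 * |x| ^ m ≤ c * |x| ^ m := by gcongr
    linarith
  have hcpt : IsCompact (Icc (-a) b ∩ {x | ρ ≤ |x|}) :=
    isCompact_Icc.inter_right (isClosed_le continuous_const continuous_abs)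
  obtain ⟨μ, hμ, hfar⟩ := hcpt.exists_forall_le' (f := fun x => h 0 - h x) (a := 0)
    (continuousOn_const.sub (hcont.mono inter_subset_left)) (by
      intro x hx
      have : x ≠ 0 := by
        rintro rfl
        have := hx.2
        simp at this; linarith
      have := hmax x hx.1 this
      linarith)
  have hAm : 0 < (a + b) ^ m := Real.rpow_pos_of_pos (by linarith) m
  set c0 := min (c1 / 2) (μ / (a + b) ^ m)
  have hc0 : 0 < c0 := lt_min (by positivity) (by positivity)
  have all : ∀ x ∈ Icc (-a) b, c0 * |x| ^ m ≤ h 0 - h x := by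
    intro x hx
    rcases eq_or_ne x 0 with rfl | hx0
    · rw [abs_zero, Real.zero_rpow (by linarith)]; simp
    rcases le_total (|x|) ρ with hh | hh
    · refine le_trans ?_ (near x hx0 hh)
      gcongr
      exact min_le_left _ _
    · refine le_trans ?_ (hfar x ⟨hx, hh⟩)
      have : |x| ^ m ≤ (a + b) ^ m := by
        apply Real.rpow_le_rpow (abs_nonneg _) _ (by linarith)
        rw [abs_le]; constructor <;> linarith [hx.1, hx.2]
      calc c0 * |x| ^ m ≤ (μ / (a + b) ^ m) * (a + b) ^ m := by
            gcongr; exact min_le_right _ _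
        _ = μ := by field_simp
  refine ⟨c0 / h 0 ^ 3, by positivity, ?_⟩
  intro x hx
  have hxp := hpos x hx
  have hle : h x ≤ h 0 := by
    rcases eq_or_ne x 0 with rfl | hx0
    · exact le_rfl
    · exact (hmax x hx hx0).le
  have e : ((h x) ^ 2)⁻¹ - ((h 0) ^ 2)⁻¹ = (h 0 - h x) * ((h 0 + h x) / (h x ^ 2 * h 0 ^ 2)) := by
    field_simp; ring
  have e2 : c0 / h 0 ^ 3 * |x| ^ m = (c0 * |x| ^ m) * (1 / h 0 ^ 3) := by ring
  rw [e, e2]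
  have hnn : 0 ≤ c0 * |x| ^ m := by positivity
  refine mul_le_mul (all x hx) ?_ (by positivity) (hnn.trans (all x hx))
  rw [div_le_div_iff₀ (by positivity) (by positivity)]
  have q1 : h x ^ 2 ≤ h 0 ^ 2 := by gcongr
  nlinarith [mul_le_mul_of_nonneg_right q1 (sq_nonneg (h 0)), pow_pos hM 3, pow_pos hM 4, mul_pos hxp (pow_pos hM 3)]


lemma grad_bdd {E : Type*} [NormedAddCommGroup E] [NormedSpace ℝ E] (U : E → ℝ) (s : Set E)
    (hs : IsCompact s) (hU : ContDiffOn ℝ 1 U s) :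
    ∃ K : ℝ, 0 ≤ K ∧ ∀ p ∈ interior s, ‖fderiv ℝ U p‖ ≤ K := by
  have : ∃ K : ℝ, 0 ≤ K ∧ ∀ p ∈ s, p ∈ interior s → ‖fderiv ℝ U p‖ ≤ K := by
    refine hs.induction_on (p := fun t => ∃ K : ℝ, 0 ≤ K ∧ ∀ p ∈ t, p ∈ interior s → ‖fderiv ℝ U p‖ ≤ K)
      ⟨0, le_rfl, by simp⟩ ?_ ?_ ?_
    · rintro t t' htt ⟨K, hK, h⟩
      exact ⟨K, hK, fun p hp => h p (htt hp)⟩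
    · rintro t t' ⟨K, hK, h⟩ ⟨K', hK', h'⟩
      refine ⟨max K K', le_max_of_le_left hK, ?_⟩
      rintro p (hp | hp) hi
      · exact (h p hp hi).trans (le_max_left _ _)
      · exact (h' p hp hi).trans (le_max_right _ _)
    · intro x hx
      have h1 := hU x hx
      rw [show (1 : WithTop ℕ∞) = 0 + 1 by simp,
        contDiffWithinAt_succ_iff_hasFDerivWithinAt' (by simp)] at h1
      obtain ⟨u, hu, husub, -, f', hf', hcf⟩ := h1
      rw [insert_eq_of_mem hx] at hu
      have hc := hcf.continuousWithinAt.norm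
      have hlt : ∀ᶠ y in nhdsWithin x s, ‖f' y‖ < ‖f' x‖ + 1 :=
        hc.eventually (gt_mem_nhds (by linarith))
      refine ⟨u ∩ {y | ‖f' y‖ < ‖f' x‖ + 1}, Filter.inter_mem hu hlt, ‖f' x‖ + 1, by positivity, ?_⟩
      rintro p ⟨hp, hp2⟩ hi
      have := (hf' p hp).hasFDerivAt (mem_interior_iff_mem_nhds.1 hi)
      rw [this.fderiv]
      exact le_of_lt hp2
  obtain ⟨K, hK, h⟩ := this
  exact ⟨K, hK, fun p hp => h p (interior_subset hp) hp⟩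

lemma fubini_region (J : Set ℝ) (hJ : MeasurableSet J) (g : ℝ → ℝ)
    (hO : MeasurableSet {p : ℝ × ℝ | p.1 ∈ J ∧ 0 < p.2 ∧ p.2 < g p.1}) (f : ℝ × ℝ → ℝ)
    (hf : IntegrableOn f {p : ℝ × ℝ | p.1 ∈ J ∧ 0 < p.2 ∧ p.2 < g p.1}) :
    (∫ p in {p : ℝ × ℝ | p.1 ∈ J ∧ 0 < p.2 ∧ p.2 < g p.1}, f p) =
      (∫ x in J, ∫ y in Ioo 0 (g x), f (x, y)) ∧
    IntegrableOn (fun x => ∫ y in Ioo 0 (g x), f (x, y)) J := by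
  have h1 := (integrable_indicator_iff hO).2 hf
  have e : ∀ x, (∫ y, indicator {p : ℝ × ℝ | p.1 ∈ J ∧ 0 < p.2 ∧ p.2 < g p.1} f (x, y)) =
      indicator J (fun x => ∫ y in Ioo 0 (g x), f (x, y)) x := by
    intro x
    by_cases hx : x ∈ J
    · rw [indicator_of_mem hx, ← MeasureTheory.integral_indicator measurableSet_Ioo]
      congr 1; ext y
      by_cases hy : y ∈ Ioo 0 (g x)
      · rw [indicator_of_mem hy, indicator_of_mem]
        exact ⟨hx, hy.1, hy.2⟩
      · rw [indicator_of_notMem hy, indicator_of_notMem]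
        exact fun h => hy ⟨h.2.1, h.2.2⟩
    · rw [indicator_of_notMem hx]
      have : ∀ y, indicator {p : ℝ × ℝ | p.1 ∈ J ∧ 0 < p.2 ∧ p.2 < g p.1} f (x, y) = 0 :=
        fun y => indicator_of_notMem (fun h => hx h.1) _
      simp [this]
  rw [Measure.volume_eq_prod] at h1
  constructor
  · rw [← MeasureTheory.integral_indicator hO, Measure.volume_eq_prod, integral_prod _ h1,
      ← MeasureTheory.integral_indicator hJ]
    simp_rw [e]
  · rw [← integrable_indicator_iff hJ]
    have := h1.integral_prod_left
    simp_rw [e] at this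
    exact this


lemma aux_ii (f : ℝ → ℝ) (hf : Measurable f) (K L : ℝ) (hL : 0 ≤ L)
    (hb : ∀ y ∈ Ioo 0 L, |f y| ≤ K) : IntervalIntegrable f volume 0 L := by
  rw [intervalIntegrable_iff_integrableOn_Ioo_of_le hL]
  refine Measure.integrableOn_of_bounded (M := K) (by simp) hf.aestronglyMeasurable ?_
  exact (ae_restrict_iff' measurableSet_Ioo).2 (Filter.Eventually.of_forall hb)

lemma aux_meas_fd (U : ℝ × ℝ → ℝ) (x : ℝ) (v : ℝ × ℝ) :
    Measurable fun y => fderiv ℝ U (x, y) v :=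
  (measurable_fderiv_apply_const ℝ U v).comp (by fun_prop : Measurable fun y : ℝ => (x, y))

lemma aux_fd_le (U : ℝ × ℝ → ℝ) (K : ℝ) (p : ℝ × ℝ) (h : ‖fderiv ℝ U p‖ ≤ K) :
    |fderiv ℝ U p (1, 0)| ≤ K ∧ |fderiv ℝ U p (0, 1)| ≤ K := by
  constructor
  · have := (fderiv ℝ U p).le_opNorm (1, 0)
    simp [Prod.norm_def] at this
    exact this.trans h
  · have := (fderiv ℝ U p).le_opNorm (0, 1)
    simp [Prod.norm_def] at this
    exact this.trans h

lemma slice_identity (J : Set ℝ) (hJ : IsOpen J) (g g' : ℝ → ℝ) (B : ℝ)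
    (hg : ∀ x ∈ J, 0 < g x) (hgd : ∀ x ∈ J, HasDerivAt g (g' x) x) (hB : ∀ x ∈ J, |g' x| ≤ B)
    (U : ℝ × ℝ → ℝ) (K : ℝ)
    (hU : ∀ x ∈ J, ∀ y ∈ Ioo 0 (g x), DifferentiableAt ℝ U (x, y))
    (hK : ∀ x ∈ J, ∀ y ∈ Ioo 0 (g x), ‖fderiv ℝ U (x, y)‖ ≤ K)
    (hc : ∀ x ∈ J, ContinuousOn (fun y => U (x, y)) (Icc 0 (g x)))
    (horth : ∀ᵐ x : ℝ, x ∈ J → ∫ y in (0:ℝ)..(g x), U (x, y) * Real.sin (π * y / g x) = 0)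
    (x₀ : ℝ) (hx₀ : x₀ ∈ J) :
    (∫ y in (0:ℝ)..(g x₀), U (x₀, y) * Real.sin (π * y / g x₀) = 0) ∧
    (∫ y in (0:ℝ)..(g x₀), fderiv ℝ U (x₀, y) (1, 0) * Real.sin (π * y / g x₀)) =
      -(g' x₀ / g x₀) * ∫ y in (0:ℝ)..(g x₀),
        y * fderiv ℝ U (x₀, y) (0, 1) * Real.sin (π * y / g x₀) := by
  set F : ℝ → ℝ → ℝ := fun x t => U (x, g x * t) * Real.sin (π * t) with hF
  set F' : ℝ → ℝ → ℝ := fun x t => (fderiv ℝ U (x, g x * t) (1, 0) +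
    g' x * t * fderiv ℝ U (x, g x * t) (0, 1)) * Real.sin (π * t) with hF'
  set Φ : ℝ → ℝ := fun x => ∫ t in (0:ℝ)..1, F x t with hΦ
  have hFc : ∀ x ∈ J, ContinuousOn (F x) (Icc 0 1) := by
    intro x hx
    refine ContinuousOn.mul ?_ (by fun_prop)
    refine (hc x hx).comp (f := fun t => g x * t) (by fun_prop) ?_
    intro t ht
    have := hg x hx
    exact ⟨mul_nonneg this.le ht.1, by nlinarith [ht.2]⟩
  have hmem : ∀ x ∈ J, ∀ t ∈ Ioo (0:ℝ) 1, g x * t ∈ Ioo 0 (g x) := by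
    intro x hx t ht
    have := hg x hx
    exact ⟨mul_pos this ht.1, by nlinarith [ht.2]⟩
  have hae1 : ∀ᵐ t : ℝ, t ≠ 1 := by
    rw [ae_iff]; simp
  have hB0 : 0 ≤ B := (abs_nonneg _).trans (hB x₀ hx₀)
  have hK0 : 0 ≤ K := (norm_nonneg _).trans (hK x₀ hx₀ (g x₀ / 2) ⟨by linarith [hg x₀ hx₀], by linarith [hg x₀ hx₀]⟩)
  have hder : ∀ x ∈ J, HasDerivAt Φ (∫ t in (0:ℝ)..1, F' x t) x := by
    intro x hx
    refine (intervalIntegral.hasDerivAt_integral_of_dominated_loc_of_deriv_le (s := J)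
      (bound := fun _ => K + B * K) (hJ.mem_nhds hx) ?_ ?_ ?_ ?_ ?_ ?_).2
    · filter_upwards [hJ.mem_nhds hx] with z hz
      rw [uIoc_of_le zero_le_one]
      exact ((hFc z hz).mono Ioc_subset_Icc_self).aestronglyMeasurable measurableSet_Ioc
    · exact ContinuousOn.intervalIntegrable_of_Icc zero_le_one (hFc x hx)
    · have h1 : Measurable fun t : ℝ => g x * t := by fun_prop
      refine Measurable.aestronglyMeasurable ?_
      refine Measurable.mul (Measurable.add ((aux_meas_fd U x (1,0)).comp h1)
        (Measurable.mul (by fun_prop) ((aux_meas_fd U x (0,1)).comp h1))) (by fun_prop)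
    · filter_upwards [hae1] with t ht1 ht z hz
      rw [uIoc_of_le zero_le_one] at ht
      have htt : t ∈ Ioo (0:ℝ) 1 := ⟨ht.1, lt_of_le_of_ne ht.2 ht1⟩
      obtain ⟨k1, k2⟩ := aux_fd_le U K _ (hK z hz _ (hmem z hz t htt))
      have k3 := Real.abs_sin_le_one (π * t)
      have k4 := hB z hz
      rw [Real.norm_eq_abs, abs_mul]
      have : |fderiv ℝ U (z, g z * t) (1, 0) + g' z * t * fderiv ℝ U (z, g z * t) (0, 1)| ≤ K + B * K := by
        refine (abs_add_le _ _).trans (add_le_add k1 ?_)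
        rw [abs_mul, abs_mul, abs_of_pos htt.1]
        calc |g' z| * t * _ ≤ B * 1 * K := by
              have := htt.1.le
              have := htt.2.le
              gcongr
          _ = _ := by ring
      calc _ ≤ (K + B * K) * 1 := by gcongr
        _ = _ := mul_one _
    · simp
    · filter_upwards [hae1] with t ht1 ht z hz
      rw [uIoc_of_le zero_le_one] at ht
      have htt : t ∈ Ioo (0:ℝ) 1 := ⟨ht.1, lt_of_le_of_ne ht.2 ht1⟩
      have hd := (hU z hz _ (hmem z hz t htt)).hasFDerivAt
      have hcurve : HasDerivAt (fun x => (x, g x * t)) ((1:ℝ), g' z * t) z :=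
        (hasDerivAt_id z).prodMk ((hgd z hz).mul_const t)
      have := (hd.comp_hasDerivAt z hcurve).mul_const (Real.sin (π * t))
      refine this.congr_deriv ?_
      simp only [hF']
      congr 1
      have e : ((1:ℝ), g' z * t) = (1, 0) + (g' z * t) • ((0:ℝ), (1:ℝ)) := by simp
      rw [e, map_add, map_smul, smul_eq_mul]
  have hsc : ∀ x ∈ J, ∀ f : ℝ → ℝ, g x * (∫ t in (0:ℝ)..1, f (g x * t)) = ∫ y in (0:ℝ)..(g x), f y := by
    intro x hx f
    have := intervalIntegral.smul_integral_comp_mul_left (a := 0) (b := 1) f (g x)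
    simpa using this
  have hΦe : ∀ x ∈ J, g x * Φ x = ∫ y in (0:ℝ)..(g x), U (x, y) * Real.sin (π * y / g x) := by
    intro x hx
    rw [← hsc x hx]
    congr 1
    simp only [hΦ, hF]
    congr 1; ext t
    have := (hg x hx).ne'
    congr 2
    field_simp
  have hz : EqOn Φ (fun _ => 0) J := by
    refine Measure.eqOn_open_of_ae_eq (μ := volume) ?_ hJ
      (fun x hx => (hder x hx).continuousAt.continuousWithinAt) continuousOn_const
    rw [Filter.EventuallyEq, ae_restrict_iff' hJ.measurableSet]
    filter_upwards [horth] with x hx hxJ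
    have h1 := hΦe x hxJ
    rw [hx hxJ] at h1
    exact (mul_eq_zero.1 h1).resolve_left (hg x hxJ).ne'
  refine ⟨by rw [← hΦe x₀ hx₀, hz hx₀]; simp, ?_⟩
  have hd0 : (∫ t in (0:ℝ)..1, F' x₀ t) = 0 := by
    have h1 := hder x₀ hx₀
    have h2 : HasDerivAt Φ 0 x₀ := by
      refine (hasDerivAt_const x₀ (0:ℝ)).congr_of_eventuallyEq ?_
      filter_upwards [hJ.mem_nhds hx₀] with z hz' using hz hz'
    exact h1.unique h2
  set L := g x₀ with hLdef
  have hL : 0 < L := hg x₀ hx₀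
  have h3 := hsc x₀ hx₀ (fun y => fderiv ℝ U (x₀, y) (1, 0) * Real.sin (π * y / L) +
    (g' x₀ / L) * (y * fderiv ℝ U (x₀, y) (0, 1) * Real.sin (π * y / L)))
  have h4 : (∫ t in (0:ℝ)..1, (fun y => fderiv ℝ U (x₀, y) (1, 0) * Real.sin (π * y / L) +
    (g' x₀ / L) * (y * fderiv ℝ U (x₀, y) (0, 1) * Real.sin (π * y / L))) (g x₀ * t)) = 0 := by
    refine Eq.trans ?_ hd0
    congr 1; ext t
    simp only [hF', ← hLdef]
    have : π * (L * t) / L = π * t := by field_simp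
    rw [this]
    field_simp
  rw [h4, mul_zero] at h3
  have hbd : ∀ y ∈ Ioo 0 L, |fderiv ℝ U (x₀, y) (1, 0)| ≤ K ∧ |fderiv ℝ U (x₀, y) (0, 1)| ≤ K :=
    fun y hy => aux_fd_le U K _ (hK x₀ hx₀ y hy)
  have i1 : IntervalIntegrable (fun y => fderiv ℝ U (x₀, y) (1, 0) * Real.sin (π * y / L)) volume 0 L := by
    refine aux_ii _ ((aux_meas_fd U x₀ _).mul (by fun_prop)) K L hL.le ?_
    intro y hy
    simp only [Pi.mul_apply]
    rw [abs_mul]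
    calc _ ≤ K * 1 := mul_le_mul (hbd y hy).1 (Real.abs_sin_le_one _) (abs_nonneg _) hK0
      _ = K := mul_one _
  have i2 : IntervalIntegrable (fun y => y * fderiv ℝ U (x₀, y) (0, 1) * Real.sin (π * y / L)) volume 0 L := by
    refine aux_ii _ ((measurable_id.mul (aux_meas_fd U x₀ _)).mul (by fun_prop)) (L * K) L hL.le ?_
    intro y hy
    simp only [Pi.mul_apply, id]
    rw [abs_mul, abs_mul, abs_of_pos hy.1]
    calc _ ≤ (L * K) * 1 := by
          refine mul_le_mul (mul_le_mul hy.2.le (hbd y hy).2 (abs_nonneg _) hL.le)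
            (Real.abs_sin_le_one _) (abs_nonneg _) (by positivity)
      _ = _ := mul_one _
  rw [intervalIntegral.integral_add i1 (i2.const_mul _), intervalIntegral.integral_const_mul] at h3
  linarith

lemma amgm_int (L N K : ℝ) (hL : 0 < L) (hN : N ^ 2 * L = 2) (f : ℝ → ℝ) (hf : Measurable f)
    (hb : ∀ y ∈ Ioo 0 L, |f y| ≤ K) (t s : ℝ) (hs : 0 < s) :
    t * N * (∫ y in (0:ℝ)..L, |f y|) ≤ s * t ^ 2 + (∫ y in (0:ℝ)..L, f y ^ 2) / (2 * s) := by
  have i1 : IntervalIntegrable (fun y => |f y|) volume 0 L :=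
    aux_ii _ (by fun_prop) K L hL.le (by simpa using hb)
  have i2 : IntervalIntegrable (fun y => f y ^ 2) volume 0 L :=
    aux_ii _ (by fun_prop) (K ^ 2) L hL.le (by
      intro y hy; rw [abs_pow]; exact pow_le_pow_left₀ (abs_nonneg _) (hb y hy) 2)
  have := intervalIntegral.integral_mono_on (μ := volume) hL.le (f := fun y => t * N * |f y|)
    (g := fun y => s / 2 * t ^ 2 * N ^ 2 + f y ^ 2 / (2 * s)) (i1.const_mul _)
    ((by simp : IntervalIntegrable (fun _ => s / 2 * t ^ 2 * N ^ 2) volume 0 L).add (i2.div_const _))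
    (fun y _ => by
      have e : s / 2 * t ^ 2 * N ^ 2 + f y ^ 2 / (2 * s) - t * N * |f y| =
        (s * t * N - |f y|) ^ 2 / (2 * s) := by
        rw [← sq_abs (f y)]; field_simp; ring
      have : 0 ≤ (s * t * N - |f y|) ^ 2 / (2 * s) := by positivity
      linarith)
  rw [intervalIntegral.integral_const_mul, intervalIntegral.integral_add (by simp) (i2.div_const _),
    intervalIntegral.integral_div, intervalIntegral.integral_const] at this
  simp only [sub_zero, smul_eq_mul] at this
  have e : L * (s / 2 * t ^ 2 * N ^ 2) = s * t ^ 2 := by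
    calc _ = s / 2 * t ^ 2 * (N ^ 2 * L) := by ring
      _ = _ := by rw [hN]; ring
  linarith

lemma num1 (R M d X Y A D : ℝ) (hR : 0 ≤ R) (hM : 0 < M) (hd : 0 < d) (hd1 : d ≤ 1)
    (hA0 : 0 ≤ A) (hD0 : 0 ≤ D) :
    R * M * d * ((2 * Y ^ 2 + 2 * R ^ 2 * X ^ 2) + D / 2) + π * R * (X ^ 2 / d + d * A / 2) ≤
    (2 * R * M + π * R + (2 + 2 * (R + π * R) ^ 2) + 2 * R ^ 3 * M) *
      (d * Y ^ 2 + X ^ 2 / d + d * (A + 3 / 4 * D)) := by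
  have hpi := Real.pi_pos
  have hXd : X ^ 2 * d ≤ X ^ 2 / d := by
    rw [le_div_iff₀ hd]
    have : d * d ≤ 1 := by nlinarith
    nlinarith [sq_nonneg X]
  have hXd1 : 0 ≤ X ^ 2 / d := by positivity
  have e1 : 0 ≤ R * M := by positivity
  have e2 : 0 ≤ R ^ 3 * M := by positivity
  have e3 : 0 ≤ π * R := by positivity
  have hdY : 0 ≤ d * Y ^ 2 := by positivity
  have hdA : 0 ≤ d * A := by positivity
  have hdD : 0 ≤ d * D := by positivity
  have e4 : 0 ≤ 2 + 2 * (R + π * R) ^ 2 := by positivity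
  generalize 2 + 2 * (R + π * R) ^ 2 = q1 at *
  generalize hx : X ^ 2 / d = x at *
  have w1 : x + d * A / 2 ≤ d * Y ^ 2 + x + d * (A + 3 / 4 * D) := by linarith
  have w2 : 2 * (d * Y ^ 2) + d * D / 2 ≤ 2 * (d * Y ^ 2 + x + d * (A + 3 / 4 * D)) := by linarith
  have w3 : X ^ 2 * d ≤ d * Y ^ 2 + x + d * (A + 3 / 4 * D) := by linarith
  generalize hV : d * Y ^ 2 + x + d * (A + 3 / 4 * D) = V at *
  have hV0 : 0 ≤ V := by linarith
  have u1 := mul_le_mul_of_nonneg_left w1 e3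
  have u2 := mul_le_mul_of_nonneg_left w2 e1
  have u3 := mul_le_mul_of_nonneg_left w3 e2
  have u4 : 0 ≤ q1 * V := by positivity
  nlinarith only [u1, u2, u3, u4]

lemma num2 (R M X Y A D : ℝ) (hR : 0 ≤ R) (hM : 0 < M)
    (hA0 : 0 ≤ A) (hD0 : 0 ≤ D) :
    2 * Y ^ 2 + 2 * (R + π * R) ^ 2 * X ^ 2 + A / 2 ≤
    (2 * R * M + π * R + (2 + 2 * (R + π * R) ^ 2) + 2 * R ^ 3 * M) *
      (1 * Y ^ 2 + X ^ 2 / 1 + 1 * (A + 3 / 4 * D)) := by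
  have hpi := Real.pi_pos
  simp only [one_mul, div_one]
  have hX := sq_nonneg X
  have hY := sq_nonneg Y
  have w1 : 2 * Y ^ 2 + A / 2 ≤ 2 * (Y ^ 2 + X ^ 2 + (A + 3 / 4 * D)) := by linarith
  have w2 : X ^ 2 ≤ (Y ^ 2 + X ^ 2 + (A + 3 / 4 * D)) := by linarith
  have e0 : 0 ≤ 2 * (R + π * R) ^ 2 := by positivity
  have e1 : 0 ≤ 2 * R * M + π * R + 2 * R ^ 3 * M := by positivity
  have hV0 : 0 ≤ (Y ^ 2 + X ^ 2 + (A + 3 / 4 * D)) := by linarith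
  have u1 := mul_le_mul_of_nonneg_left w2 e0
  have u2 := mul_nonneg e1 hV0
  linarith

lemma slice_bound (L N K X Y r R M d : ℝ) (hL : 0 < L) (hN0 : 0 ≤ N) (hN : N ^ 2 * L = 2)
    (hM : 0 < M) (hd : 0 < d) (hd1 : d ≤ 1) (hcase : L ≤ M * d ∨ d = 1)
    (hr : |r| ≤ R) (ux uy : ℝ → ℝ) (mx : Measurable ux) (my : Measurable uy)
    (hbx : ∀ y ∈ Ioo 0 L, |ux y| ≤ K) (hby : ∀ y ∈ Ioo 0 L, |uy y| ≤ K)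
    (hid : (∫ y in (0:ℝ)..L, ux y * Real.sin (π * y / L)) =
      - r * ∫ y in (0:ℝ)..L, y * uy y * Real.sin (π * y / L)) :
    |∫ y in (0:ℝ)..L, ((Y - X * r / 2) * N * Real.sin (π * y / L) +
      X * N * (-(π * y * r / L) * Real.cos (π * y / L))) * ux y| ≤
    (2 * R * M + π * R + (2 + 2 * (R + π * R) ^ 2) + 2 * R ^ 3 * M) *
      (d * Y ^ 2 + X ^ 2 / d + d * ((∫ y in (0:ℝ)..L, ux y ^ 2) + 3 / 4 * ∫ y in (0:ℝ)..L, uy y ^ 2)) := by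
  have hpi := Real.pi_pos
  have hR : 0 ≤ R := (abs_nonneg _).trans hr
  have hK : 0 ≤ K := (abs_nonneg _).trans (hbx (L/2) ⟨by linarith, by linarith⟩)
  have iax : IntervalIntegrable (fun y => |ux y|) volume 0 L :=
    aux_ii _ (by fun_prop) K L hL.le (by simpa using hbx)
  have iay : IntervalIntegrable (fun y => |uy y|) volume 0 L :=
    aux_ii _ (by fun_prop) K L hL.le (by simpa using hby)
  have i1 : IntervalIntegrable (fun y => ux y * Real.sin (π * y / L)) volume 0 L :=
    (aux_ii _ mx K L hL.le hbx).mul_continuousOn (by fun_prop)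
  have i2 : IntervalIntegrable (fun y => ux y * (-(π * y * r / L) * Real.cos (π * y / L))) volume 0 L :=
    (aux_ii _ mx K L hL.le hbx).mul_continuousOn (by fun_prop)
  have i3 : IntervalIntegrable (fun y => uy y * (y * Real.sin (π * y / L))) volume 0 L :=
    (aux_ii _ my K L hL.le hby).mul_continuousOn (by fun_prop)
  have esplit : (∫ y in (0:ℝ)..L, ((Y - X * r / 2) * N * Real.sin (π * y / L) +
      X * N * (-(π * y * r / L) * Real.cos (π * y / L))) * ux y) =
      (Y - X * r / 2) * N * (∫ y in (0:ℝ)..L, ux y * Real.sin (π * y / L)) +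
      X * N * (∫ y in (0:ℝ)..L, ux y * (-(π * y * r / L) * Real.cos (π * y / L))) := by
    rw [← intervalIntegral.integral_const_mul, ← intervalIntegral.integral_const_mul,
      ← intervalIntegral.integral_add (i1.const_mul _) (i2.const_mul _)]
    congr 1; ext y; ring
  set Ix := ∫ y in (0:ℝ)..L, |ux y| with hIx
  set Iy := ∫ y in (0:ℝ)..L, |uy y| with hIy
  set A := ∫ y in (0:ℝ)..L, ux y ^ 2 with hA
  set D := ∫ y in (0:ℝ)..L, uy y ^ 2 with hD
  have hA0 : 0 ≤ A := intervalIntegral.integral_nonneg hL.le fun y _ => sq_nonneg _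
  have hD0 : 0 ≤ D := intervalIntegral.integral_nonneg hL.le fun y _ => sq_nonneg _
  have hIx0 : 0 ≤ Ix := intervalIntegral.integral_nonneg hL.le fun y _ => abs_nonneg _
  have hIy0 : 0 ≤ Iy := intervalIntegral.integral_nonneg hL.le fun y _ => abs_nonneg _
  have b1 : |∫ y in (0:ℝ)..L, ux y * Real.sin (π * y / L)| ≤ Ix := by
    refine (intervalIntegral.abs_integral_le_integral_abs hL.le).trans ?_
    refine intervalIntegral.integral_mono_on hL.le i1.abs iax fun y hy => ?_
    rw [abs_mul]
    exact mul_le_of_le_one_right (abs_nonneg _) (Real.abs_sin_le_one _)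
  have b2 : |∫ y in (0:ℝ)..L, ux y * (-(π * y * r / L) * Real.cos (π * y / L))| ≤ π * R * Ix := by
    refine (intervalIntegral.abs_integral_le_integral_abs hL.le).trans ?_
    rw [hIx, ← intervalIntegral.integral_const_mul]
    refine intervalIntegral.integral_mono_on hL.le i2.abs (iax.const_mul _) fun y hy => ?_
    rw [abs_mul, mul_comm]
    refine mul_le_mul_of_nonneg_right ?_ (abs_nonneg _)
    rw [abs_mul, abs_neg]
    have : |π * y * r / L| ≤ π * R := by
      rw [abs_div, abs_mul, abs_mul, abs_of_pos hpi, abs_of_pos hL, abs_of_nonneg hy.1,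
        div_le_iff₀ hL]
      calc π * y * |r| ≤ π * L * R := by gcongr; exact hy.2
        _ = _ := by ring
    exact (mul_le_of_le_one_right (abs_nonneg _) (Real.abs_cos_le_one _)).trans this
  have b3 : |∫ y in (0:ℝ)..L, ux y * Real.sin (π * y / L)| ≤ R * L * Iy := by
    rw [hid, abs_mul, abs_neg, mul_assoc]
    refine mul_le_mul hr ?_ (abs_nonneg _) hR
    refine (intervalIntegral.abs_integral_le_integral_abs hL.le).trans ?_
    rw [hIy, ← intervalIntegral.integral_const_mul]
    have i3' : IntervalIntegrable (fun y => y * uy y * Real.sin (π * y / L)) volume 0 L := by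
      convert i3 using 2; ring
    refine intervalIntegral.integral_mono_on hL.le i3'.abs (iay.const_mul _) fun y hy => ?_
    rw [abs_mul, abs_mul, abs_of_nonneg hy.1]
    refine (mul_le_of_le_one_right (by have := hy.1; positivity) (Real.abs_sin_le_one _)).trans ?_
    gcongr
    exact hy.2
  have hP : |Y - X * r / 2| ≤ |Y| + R * |X| := by
    refine (abs_sub _ _).trans ?_
    gcongr
    rw [abs_div, abs_mul, abs_of_pos (by norm_num : (0:ℝ) < 2)]
    have : |X| * |r| ≤ |X| * R := by gcongr
    have := mul_nonneg (abs_nonneg X) (abs_nonneg r)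
    linarith
  have hX := abs_nonneg X
  have hY := abs_nonneg Y
  have hmain : ∀ Q, |∫ y in (0:ℝ)..L, ux y * Real.sin (π * y / L)| ≤ Q →
      |∫ y in (0:ℝ)..L, ((Y - X * r / 2) * N * Real.sin (π * y / L) +
      X * N * (-(π * y * r / L) * Real.cos (π * y / L))) * ux y| ≤
      (|Y| + R * |X|) * N * Q + |X| * N * (π * R * Ix) := by
    intro Q hQ
    rw [esplit]
    refine (abs_add_le _ _).trans ?_
    rw [abs_mul, abs_mul, abs_mul (X * N), abs_mul X, abs_of_nonneg hN0]
    gcongr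
  have hsq : (|Y| + R * |X|) ^ 2 ≤ 2 * Y ^ 2 + 2 * R ^ 2 * X ^ 2 := by
    rw [← sq_abs Y, ← sq_abs X]; nlinarith [sq_nonneg (|Y| - R * |X|)]
  rcases hcase with hc | hc
  · have hlt : (|Y| + R * |X|) * N * (R * L * Iy) ≤ R * M * d * ((2 * Y ^ 2 + 2 * R ^ 2 * X ^ 2) + D / 2) := by
      have h1 := amgm_int L N K hL hN uy my hby (|Y| + R * |X|) 1 one_pos
      calc (|Y| + R * |X|) * N * (R * L * Iy) = (R * L) * ((|Y| + R * |X|) * N * Iy) := by ring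
        _ ≤ (R * (M * d)) * ((|Y| + R * |X|) * N * Iy) := by gcongr
        _ ≤ (R * (M * d)) * ((2 * Y ^ 2 + 2 * R ^ 2 * X ^ 2) + D / 2) := by
            gcongr
            refine h1.trans ?_
            rw [one_mul, mul_one]
            gcongr
        _ = _ := by ring
    have h2 := amgm_int L N K hL hN ux mx hbx (|X|) (1 / d) (by positivity)
    have h3 : |X| * N * (π * R * Ix) ≤ π * R * (X ^ 2 / d + d * A / 2) := by
      calc |X| * N * (π * R * Ix) = π * R * (|X| * N * Ix) := by ring
        _ ≤ π * R * (1 / d * |X| ^ 2 + A / (2 * (1 / d))) := by gcongr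
        _ = _ := by rw [sq_abs]; field_simp
    refine (hmain _ b3).trans ((add_le_add hlt h3).trans ?_)
    exact num1 R M d X Y A D hR hM hd hd1 hA0 hD0
  · have h1 := amgm_int L N K hL hN ux mx hbx (|Y| + (R + π * R) * |X|) 1 one_pos
    have hsq2 : (|Y| + (R + π * R) * |X|) ^ 2 ≤ 2 * Y ^ 2 + 2 * (R + π * R) ^ 2 * X ^ 2 := by
      rw [← sq_abs Y, ← sq_abs X]; nlinarith [sq_nonneg (|Y| - (R + π * R) * |X|)]
    refine (hmain _ b1).trans ?_
    have h2 : (|Y| + R * |X|) * N * Ix + |X| * N * (π * R * Ix) =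
      (|Y| + (R + π * R) * |X|) * N * Ix := by ring
    rw [h2]
    refine h1.trans ?_
    subst hc
    refine le_trans ?_ (num2 R M X Y A D hR hM hA0 hD0)
    rw [one_mul, mul_one]
    gcongr

lemma q_lower (a b m α c ε : ℝ) (ha : 0 < a) (hb : 0 < b) (hm : 1 ≤ m) (hα : α = 2 / (m + 2))
    (hc : 0 < c) (hε : 0 < ε) (χ χ' : ℝ → ℝ)
    (hd : ∀ x, HasDerivAt χ (χ' x) x) (hcχ : Continuous χ')
    (h1 : χ (-a) = 0) (h2 : χ b = 0) (w : ℝ → ℝ) (hw : IntervalIntegrable w volume (-a) b)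
    (hwl : ∀ x ∈ Ioo (-a) b, x ≠ 0 → χ' x ^ 2 + π ^ 2 / ε ^ 2 * (c * |x| ^ m) * χ x ^ 2 ≤ w x) :
    (∫ x in (-a)..b, χ' x ^ 2) ≤ (∫ x in (-a)..b, w x) ∧
    (∫ x in (-a)..b, χ x ^ 2) ≤ 4 * (a + b) ^ 2 * (∫ x in (-a)..b, w x) ∧
    (∫ x in (-a)..b, χ x ^ 2) ≤
      2 * (1 + 2 * 4 ^ m / (c * π ^ 2)) * (ε ^ α) ^ 2 * (∫ x in (-a)..b, w x) := by
  have hpi := Real.pi_pos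
  have hχ : Continuous χ := continuous_iff_continuousAt.2 fun x => (hd x).continuousAt
  have hab : -a ≤ b := by linarith
  have hmc : Continuous fun x : ℝ => |x| ^ m :=
    continuous_abs.rpow_const fun x => Or.inr (by linarith)
  have hae : ∀ᵐ x : ℝ, x ∉ ({-a, b, 0} : Set ℝ) :=
    (Set.Finite.countable (by simp)).ae_notMem volume
  have mono : ∀ f : ℝ → ℝ, Continuous f → (∀ x ∈ Ioo (-a) b, x ≠ 0 → f x ≤ w x) →
      (∫ x in (-a)..b, f x) ≤ ∫ x in (-a)..b, w x := by
    intro f hf hfw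
    refine intervalIntegral.integral_mono_ae_restrict hab (hf.intervalIntegrable _ _) hw ?_
    rw [Filter.EventuallyLE, ae_restrict_iff' measurableSet_Icc]
    filter_upwards [hae] with x hx hxI
    simp only [mem_insert_iff, mem_singleton_iff, not_or] at hx
    exact hfw x ⟨lt_of_le_of_ne hxI.1 (Ne.symm hx.1), lt_of_le_of_ne hxI.2 hx.2.1⟩ hx.2.2
  have r1 : (∫ x in (-a)..b, χ' x ^ 2) ≤ (∫ x in (-a)..b, w x) := by
    refine mono _ (by fun_prop) fun x hx hx0 => ?_
    have : 0 ≤ π ^ 2 / ε ^ 2 * (c * |x| ^ m) * χ x ^ 2 := by positivity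
    linarith [hwl x hx hx0]
  refine ⟨r1, (poinc_x a b ha hb χ χ' hd hcχ h1 h2).trans (by gcongr), ?_⟩
  set δ := ε ^ α with hδ
  have hδp : 0 < δ := Real.rpow_pos_of_pos hε α
  have e : (δ ^ m)⁻¹ = δ ^ 2 / ε ^ 2 := by
    rw [hδ, ← Real.rpow_mul hε.le, ← Real.rpow_natCast (ε ^ α) 2, ← Real.rpow_mul hε.le,
      ← Real.rpow_natCast ε 2, ← Real.rpow_sub hε, ← Real.rpow_neg hε.le]
    congr 1
    rw [hα]; push_cast
    field_simp
    ring
  have h3 := osc a b m δ hab hm hδp χ χ' hd hcχ h1 h2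
  set k := 1 + 2 * 4 ^ m / (c * π ^ 2) with hk
  have h4m : (0:ℝ) < 4 ^ m := by positivity
  have hkp : 0 < k := by positivity
  have h5 := mono (fun x => (k * δ ^ 2)⁻¹ * (δ ^ 2 * χ' x ^ 2
      + 2 * 4 ^ m * (δ ^ m)⁻¹ * (|x| ^ m * χ x ^ 2))) (by fun_prop) (by
    intro x hx hx0
    refine le_trans ?_ (hwl x hx hx0)
    rw [inv_mul_le_iff₀ (by positivity), e]
    have hz : 0 ≤ |x| ^ m * χ x ^ 2 := by positivity
    generalize |x| ^ m = z at *
    have t1 : k * δ ^ 2 * (χ' x ^ 2 + π ^ 2 / ε ^ 2 * (c * z) * χ x ^ 2) =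
      k * δ ^ 2 * χ' x ^ 2 + (k * c * π ^ 2) * (δ ^ 2 / ε ^ 2 * (z * χ x ^ 2)) := by ring
    have t2 : k * c * π ^ 2 = c * π ^ 2 + 2 * 4 ^ m := by rw [hk]; field_simp
    have t3 : 1 ≤ k := by rw [hk]; have : 0 < 2 * 4 ^ m / (c * π ^ 2) := by positivity
                          linarith
    have t4 : 0 ≤ c * π ^ 2 * (δ ^ 2 / ε ^ 2 * (z * χ x ^ 2)) := by positivity
    have t5 : δ ^ 2 * χ' x ^ 2 ≤ k * δ ^ 2 * χ' x ^ 2 := by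
      have : 0 ≤ δ ^ 2 * χ' x ^ 2 := by positivity
      nlinarith
    rw [t1, t2]
    nlinarith)
  rw [intervalIntegral.integral_const_mul, inv_mul_le_iff₀ (by positivity)] at h5
  linarith

lemma psi_deriv (χ h : ℝ → ℝ) (ε x y Y h' : ℝ) (hε : 0 < ε) (hx : 0 < h x)
    (hχ : HasDerivAt χ Y x) (hh : HasDerivAt h h' x) :
    deriv (fun s => χ s * Real.sqrt (2 / (ε * h s)) * Real.sin (π * y / (ε * h s))) x =
      (Y - χ x * (h' / h x) / 2) * Real.sqrt (2 / (ε * h x)) * Real.sin (π * y / (ε * h x)) +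
      χ x * Real.sqrt (2 / (ε * h x)) *
        (-(π * y * (h' / h x) / (ε * h x)) * Real.cos (π * y / (ε * h x))) := by
  have hp : 0 < ε * h x := by positivity
  have d1 : HasDerivAt (fun s => ε * h s) (ε * h') x := hh.const_mul ε
  have d2 : HasDerivAt (fun s => 2 / (ε * h s)) _ x := (hasDerivAt_const x (2:ℝ)).div d1 hp.ne'
  have d3 : HasDerivAt (fun s => π * y / (ε * h s)) _ x := (hasDerivAt_const x (π * y)).div d1 hp.ne'
  have hpos : 0 < 2 / (ε * h x) := by positivity
  have d4 := d2.sqrt hpos.ne'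
  have d5 := (hχ.mul d4).mul d3.sin
  refine d5.deriv.trans ?_
  have hN : 0 < Real.sqrt (2 / (ε * h x)) := Real.sqrt_pos.2 hpos
  have hN2 : Real.sqrt (2 / (ε * h x)) ^ 2 * (ε * h x) = 2 := by
    rw [Real.sq_sqrt hpos.le]; field_simp
  simp only [Pi.mul_apply]
  generalize Real.sqrt (2 / (ε * h x)) = N at *
  generalize Real.sin (π * y / (ε * h x)) = S
  generalize Real.cos (π * y / (ε * h x)) = c
  have e : (0 * (ε * h x) - 2 * (ε * h')) / (ε * h x) ^ 2 / (2 * N) = - N * (h' / h x) / 2 := by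
    have : N ^ 2 = 2 / (ε * h x) := by rw [eq_div_iff hp.ne']; exact hN2
    field_simp
    field_simp at this
    linear_combination h' * this
  rw [e]
  field_simp
  ring


lemma geom (a b ε : ℝ) (hε : 0 < ε) (h : ℝ → ℝ)
    (hcont : ContinuousOn h (Icc (-a) b)) (M : ℝ)
    (hpos : ∀ x ∈ Icc (-a) b, 0 < h x) (hM : ∀ x ∈ Icc (-a) b, h x ≤ M)
    (U : ℝ × ℝ → ℝ) (Ω J O) (hΩ : Ω = {p : ℝ × ℝ | p.1 ∈ Icc (-a) b ∧ 0 < p.2 ∧ p.2 < ε * h p.1})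
    (hJ : J = Ioo (-a) b \ {0})
    (hOd : O = {p : ℝ × ℝ | p.1 ∈ J ∧ 0 < p.2 ∧ p.2 < ε * h p.1})
    (hU : ContDiffOn ℝ 1 U (closure Ω)) (hU0 : ∀ p ∈ frontier Ω, U p = 0) :
    IsOpen J ∧ IsOpen O ∧ Ω =ᵐ[volume] O ∧ volume O < ⊤ ∧
    (∃ K, 0 ≤ K ∧ ∀ p ∈ O, DifferentiableAt ℝ U p ∧ ‖fderiv ℝ U p‖ ≤ K ∧ |U p| ≤ K) ∧
    ContinuousOn (fderiv ℝ U) O ∧ ContinuousOn U O ∧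
    (∀ x ∈ J, ContinuousOn (fun y => U (x, y)) (Icc 0 (ε * h x)) ∧
      U (x, 0) = 0 ∧ U (x, ε * h x) = 0) := by
  have hJI : J ⊆ Icc (-a) b := by rw [hJ]; exact sdiff_subset.trans Ioo_subset_Icc_self
  have hJo : IsOpen J := by rw [hJ]; exact isOpen_Ioo.sdiff isClosed_singleton
  have hOo : IsOpen O := by
    have hc : ContinuousOn (fun p : ℝ × ℝ => ε * h p.1 - p.2) (Prod.fst ⁻¹' J) := by
      refine ContinuousOn.sub (ContinuousOn.mul continuousOn_const ?_) continuousOn_snd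
      exact (hcont.mono hJI).comp continuousOn_fst (fun p hp => hp)
    have h1 := hc.isOpen_inter_preimage (hJo.preimage continuous_fst) (isOpen_Ioi (a := (0:ℝ)))
    have h2 : O = (Prod.fst ⁻¹' J ∩ (fun p : ℝ × ℝ => ε * h p.1 - p.2) ⁻¹' Ioi 0) ∩
        Prod.snd ⁻¹' Ioi 0 := by
      rw [hOd]; ext p; simp; tauto
    rw [h2]; exact h1.inter (isOpen_Ioi.preimage continuous_snd)
  have hOΩ : O ⊆ Ω := by
    rw [hOd, hΩ]; rintro p ⟨h1, h2⟩; exact ⟨hJI h1, h2⟩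
  have hOint : O ⊆ interior (closure Ω) :=
    interior_maximal (hOΩ.trans subset_closure) hOo
  have hsub : Ω ⊆ Icc (-a) b ×ˢ Icc 0 (ε * M) := by
    rw [hΩ]; rintro p ⟨h1, h2, h3⟩
    exact ⟨h1, h2.le, h3.le.trans (mul_le_mul_of_nonneg_left (hM _ h1) hε.le)⟩
  have hcK : IsCompact (Icc (-a) b ×ˢ Icc 0 (ε * M)) := isCompact_Icc.prod isCompact_Icc
  have hcpt : IsCompact (closure Ω) :=
    hcK.of_isClosed_subset isClosed_closure (closure_minimal hsub hcK.isClosed)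
  have hmem : ∀ x ∈ J, ∀ y ∈ Icc 0 (ε * h x), (x, y) ∈ closure Ω := by
    intro x hx y hy
    have hp : 0 < ε * h x := mul_pos hε (hpos x (hJI hx))
    have : y ∈ closure (Ioo 0 (ε * h x)) := by rw [closure_Ioo hp.ne]; exact hy
    refine map_mem_closure (f := fun y => (x, y)) (by fun_prop) this ?_
    intro t ht; rw [hΩ]; exact ⟨hJI hx, ht.1, ht.2⟩
  have hcO : ContDiffOn ℝ 1 U O := hU.mono (hOint.trans interior_subset)
  refine ⟨hJo, hOo, ?_, ?_, ?_, hcO.continuousOn_fderiv_of_isOpen hOo le_rfl, hcO.continuousOn, ?_⟩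
  · have hn : volume (({-a, 0, b} : Set ℝ) ×ˢ (univ : Set ℝ)) = 0 := by
      rw [Measure.volume_eq_prod, Measure.prod_prod, (Set.Finite.measure_zero (by simp) volume), zero_mul]
    have := measure_eq_zero_iff_ae_notMem.1 hn
    filter_upwards [this] with p hp
    simp only [mem_prod, mem_univ, and_true, mem_insert_iff, mem_singleton_iff, not_or] at hp
    apply propext
    change p ∈ Ω ↔ p ∈ O
    refine ⟨fun hq => ?_, fun hq => hOΩ hq⟩
    rw [hΩ] at hq
    rw [hOd, hJ]
    exact ⟨⟨⟨lt_of_le_of_ne hq.1.1 (Ne.symm hp.1), lt_of_le_of_ne hq.1.2 hp.2.2⟩, hp.2.1⟩, hq.2⟩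
  · exact lt_of_le_of_lt (measure_mono (hOΩ.trans hsub)) hcK.measure_lt_top
  · obtain ⟨K, hK0, hK⟩ := grad_bdd U _ hcpt hU
    obtain ⟨K2, hK2⟩ := hcpt.exists_bound_of_continuousOn hU.continuousOn
    refine ⟨max K K2, le_max_of_le_left hK0, fun p hp => ⟨?_, ?_, ?_⟩⟩
    · exact (hcO.differentiableOn one_ne_zero).differentiableAt (hOo.mem_nhds hp)
    · exact (hK p (hOint hp)).trans (le_max_left _ _)
    · exact (hK2 p (interior_subset (hOint hp))).trans (le_max_right _ _)
  · intro x hx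
    have hp : 0 < ε * h x := mul_pos hε (hpos x (hJI hx))
    refine ⟨hU.continuousOn.comp (by fun_prop) (fun y hy => hmem x hx y hy), ?_, ?_⟩
    · refine hU0 _ ⟨hmem x hx _ ⟨le_rfl, hp.le⟩, fun hi => ?_⟩
      have := interior_subset hi
      rw [hΩ] at this; exact lt_irrefl _ this.2.1
    · refine hU0 _ ⟨hmem x hx _ ⟨hp.le, le_rfl⟩, fun hi => ?_⟩
      have := interior_subset hi
      rw [hΩ] at this; exact lt_irrefl _ this.2.2

lemma intg_of {E : Type*} [TopologicalSpace E] [MeasurableSpace E] [OpensMeasurableSpace E]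
    (μ : Measure E) (O : Set E) (hO : IsOpen O) (hv : μ O < ⊤) (f : E → ℝ)
    (hf : ContinuousOn f O) (C : ℝ) (hC : ∀ p ∈ O, |f p| ≤ C) : IntegrableOn f O μ := by
  refine IntegrableOn.of_bound hv (ContinuousOn.aestronglyMeasurable hf hO.measurableSet) C ?_
  exact (ae_restrict_iff' hO.measurableSet).2 (Filter.Eventually.of_forall hC)

lemma fd_slices (U : ℝ × ℝ → ℝ) (p : ℝ × ℝ) (hU : DifferentiableAt ℝ U p) :
    HasDerivAt (fun s => U (s, p.2)) (fderiv ℝ U p (1, 0)) p.1 ∧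
    HasDerivAt (fun t => U (p.1, t)) (fderiv ℝ U p (0, 1)) p.2 := by
  constructor
  · exact hU.hasFDerivAt.comp_hasDerivAt (f := fun s => (s, p.2)) p.1
      ((hasDerivAt_id p.1).prodMk (hasDerivAt_const p.1 p.2))
  · exact hU.hasFDerivAt.comp_hasDerivAt (f := fun s => (p.1, s)) p.2
      ((hasDerivAt_const p.2 p.1).prodMk (hasDerivAt_id p.2))


lemma core (a b ε : ℝ) (hε : 0 < ε) (h : ℝ → ℝ)
    (hcont : ContinuousOn h (Icc (-a) b)) (M : ℝ) (hM0 : 0 < M)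
    (hM : ∀ x ∈ Icc (-a) b, h x ≤ M) (h1 : ℝ) (hh1 : 0 < h1) (hlow : ∀ x ∈ Icc (-a) b, h1 ≤ h x)
    (U : ℝ × ℝ → ℝ) (Ω J O) (hΩ : Ω = {p : ℝ × ℝ | p.1 ∈ Icc (-a) b ∧ 0 < p.2 ∧ p.2 < ε * h p.1})
    (hJ : J = Ioo (-a) b \ {0})
    (hOd : O = {p : ℝ × ℝ | p.1 ∈ J ∧ 0 < p.2 ∧ p.2 < ε * h p.1})
    (hU : ContDiffOn ℝ 1 U (closure Ω)) (hU0 : ∀ p ∈ frontier Ω, U p = 0)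
    (horth : ∀ᵐ x : ℝ, x ∈ Icc (-a) b →
          ∫ y in (0:ℝ)..(ε * h x), U (x, y) * Real.sin (π * y / (ε * h x)) = 0)
    (B R : ℝ) (hh : ∀ x ∈ J, HasDerivAt h (deriv h x) x) (hdc : ContinuousOn (deriv h) J)
    (hB : ∀ x ∈ J, |deriv h x| ≤ B) (hR0 : 0 ≤ R) (hR : ∀ x ∈ J, |deriv h x / h x| ≤ R)
    (χ χ' : ℝ → ℝ) (hχ : ∀ x, HasDerivAt χ (χ' x) x) (hχc : Continuous χ') (Kχ : ℝ)
    (hk : ∀ x, |χ x| ≤ Kχ) (hk' : ∀ x, |χ' x| ≤ Kχ)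
    (d : ℝ) (hd : 0 < d) (hd1 : d ≤ 1) (hcase : ε ≤ d ∨ d = 1) :
    0 ≤ (∫ p in Ω, (gradSq U p - π ^ 2 / (M ^ 2 * ε ^ 2) * U p ^ 2)) ∧
    |∫ p in Ω, deriv (fun s => χ s * Real.sqrt (2 / (ε * h s)) *
              Real.sin (π * p.2 / (ε * h s))) p.1 * deriv (fun s => U (s, p.2)) p.1| ≤
      (2 * R * M + π * R + (2 + 2 * (R + π * R) ^ 2) + 2 * R ^ 3 * M) *
      (d * (∫ x in J, χ' x ^ 2) + (∫ x in J, χ x ^ 2) / d +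
        d * (∫ p in Ω, (gradSq U p - π ^ 2 / (M ^ 2 * ε ^ 2) * U p ^ 2))) := by
  have hpi := Real.pi_pos
  have hpos : ∀ x ∈ Icc (-a) b, 0 < h x := fun x hx => hh1.trans_le (hlow x hx)
  obtain ⟨hJo, hOo, hΩO, hvol, ⟨K, hK0, hK⟩, hfc, hUc, hsl⟩ :=
    geom a b ε hε h hcont M hpos hM U Ω J O hΩ hJ hOd hU hU0
  have hJI : J ⊆ Icc (-a) b := by rw [hJ]; exact sdiff_subset.trans Ioo_subset_Icc_self
  have hχcont : Continuous χ := continuous_iff_continuousAt.2 fun x => (hχ x).continuousAt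
  have hkk : 0 ≤ Kχ := (abs_nonneg _).trans (hk 0)
  have hp : ∀ x ∈ J, 0 < ε * h x := fun x hx => mul_pos hε (hpos x (hJI hx))
  set κ := π ^ 2 / (M ^ 2 * ε ^ 2) with hκ
  have hκ0 : 0 ≤ κ := by positivity
  have hOm := hOo.measurableSet
  have hmemO : ∀ x y, (x, y) ∈ O ↔ x ∈ J ∧ y ∈ Ioo 0 (ε * h x) := by
    intro x y; rw [hOd]; rfl
  set F1 : ℝ × ℝ → ℝ := fun p =>
    ((χ' p.1 - χ p.1 * (deriv h p.1 / h p.1) / 2) * Real.sqrt (2 / (ε * h p.1))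
        * Real.sin (π * p.2 / (ε * h p.1)) +
      χ p.1 * Real.sqrt (2 / (ε * h p.1)) *
        (-(π * p.2 * (deriv h p.1 / h p.1) / (ε * h p.1)) * Real.cos (π * p.2 / (ε * h p.1))))
      * fderiv ℝ U p (1, 0) with hF1
  set F2 : ℝ × ℝ → ℝ := fun p =>
    (fderiv ℝ U p (1, 0)) ^ 2 + (fderiv ℝ U p (0, 1)) ^ 2 - κ * U p ^ 2 with hF2
  have e1 : (∫ p in Ω, deriv (fun s => χ s * Real.sqrt (2 / (ε * h s)) *
              Real.sin (π * p.2 / (ε * h s))) p.1 * deriv (fun s => U (s, p.2)) p.1) =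
      ∫ p in O, F1 p := by
    rw [setIntegral_congr_set hΩO]
    refine setIntegral_congr_fun hOm fun p hpO => ?_
    have hpJ := ((hmemO p.1 p.2).1 hpO).1
    simp only [hF1]
    rw [psi_deriv χ h ε p.1 p.2 (χ' p.1) (deriv h p.1) hε (hpos _ (hJI hpJ)) (hχ _) (hh _ hpJ),
      (fd_slices U p (hK p hpO).1).1.deriv]
  have e2 : (∫ p in Ω, (gradSq U p - κ * U p ^ 2)) = ∫ p in O, F2 p := by
    rw [setIntegral_congr_set hΩO]
    refine setIntegral_congr_fun hOm fun p hpO => ?_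
    simp only [hF2, gradSq]
    rw [(fd_slices U p (hK p hpO).1).1.deriv, (fd_slices U p (hK p hpO).1).2.deriv]
  rw [e1, e2]
  have cx : ContinuousOn (fun p => fderiv ℝ U p (1, 0)) O := hfc.clm_apply continuousOn_const
  have cy : ContinuousOn (fun p => fderiv ℝ U p (0, 1)) O := hfc.clm_apply continuousOn_const
  have hfst : MapsTo Prod.fst O J := fun p hp => ((hmemO p.1 p.2).1 hp).1
  have ch : ContinuousOn (fun p : ℝ × ℝ => h p.1) O :=
    (hcont.mono hJI).comp continuousOn_fst hfst
  have cdh : ContinuousOn (fun p : ℝ × ℝ => deriv h p.1) O :=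
    hdc.comp continuousOn_fst hfst
  have hne : ∀ p ∈ O, h p.1 ≠ 0 := fun p hp => (hpos _ (hJI (hfst hp))).ne'
  have hne' : ∀ p ∈ O, ε * h p.1 ≠ 0 := fun p hp => mul_ne_zero hε.ne' (hne p hp)
  have i1 : IntegrableOn F1 O := by
    refine intg_of volume O hOo hvol F1 ?_
      (((Kχ + Kχ * R / 2) * Real.sqrt (2 / (ε * h1)) * 1 +
        Kχ * Real.sqrt (2 / (ε * h1)) * (π * R * 1)) * K) ?_
    · have c1 : ContinuousOn (fun p : ℝ × ℝ => deriv h p.1 / h p.1) O := cdh.div ch hne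
      have c2 : ContinuousOn (fun p : ℝ × ℝ => Real.sqrt (2 / (ε * h p.1))) O :=
        (continuousOn_const.div (continuousOn_const.mul ch) hne').sqrt
      have c3 : ContinuousOn (fun p : ℝ × ℝ => π * p.2 / (ε * h p.1)) O :=
        (ContinuousOn.mul continuousOn_const continuousOn_snd).div (continuousOn_const.mul ch) hne'
      have c4 : ContinuousOn (fun p : ℝ × ℝ => π * p.2 * (deriv h p.1 / h p.1) / (ε * h p.1)) O :=
        ((ContinuousOn.mul continuousOn_const continuousOn_snd).mul c1).div
          (continuousOn_const.mul ch) hne'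
      have c5 : ContinuousOn (fun p : ℝ × ℝ => χ p.1) O := by fun_prop
      have c6 : ContinuousOn (fun p : ℝ × ℝ => χ' p.1) O := by fun_prop
      have c7 := Real.continuous_sin.comp_continuousOn c3
      have c8 := Real.continuous_cos.comp_continuousOn c3
      exact ((((c6.sub ((c5.mul c1).div_const 2)).mul c2).mul c7).add
        ((c5.mul c2).mul (c4.neg.mul c8))).mul cx
    · intro p hpO
      obtain ⟨hpJ, hy0, hy1⟩ := (hmemO p.1 p.2).1 hpO
      have hL := hp _ hpJ
      have b1 := (aux_fd_le U K p (hK p hpO).2.1).1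
      have b2 : Real.sqrt (2 / (ε * h p.1)) ≤ Real.sqrt (2 / (ε * h1)) := by
        apply Real.sqrt_le_sqrt
        have := hlow _ (hJI hpJ)
        gcongr
      have b3 := hR _ hpJ
      have b4 : |-(π * p.2 * (deriv h p.1 / h p.1) / (ε * h p.1))| ≤ π * R := by
        rw [show -(π * p.2 * (deriv h p.1 / h p.1) / (ε * h p.1)) =
          -(π * (deriv h p.1 / h p.1) * (p.2 / (ε * h p.1))) by ring, abs_neg, abs_mul, abs_mul,
          abs_of_pos hpi, abs_of_nonneg (div_nonneg hy0.le hL.le)]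
        have : p.2 / (ε * h p.1) ≤ 1 := (div_le_one hL).2 hy1.le
        calc π * |deriv h p.1 / h p.1| * (p.2 / (ε * h p.1)) ≤ π * R * 1 := by
              gcongr
          _ = _ := by ring
      have b5 : |χ' p.1 - χ p.1 * (deriv h p.1 / h p.1) / 2| ≤ Kχ + Kχ * R / 2 := by
        refine (abs_sub _ _).trans ?_
        rw [abs_div, abs_mul, abs_two]
        have := hk p.1
        have := hk' p.1
        gcongr
      simp only [hF1]
      rw [abs_mul]
      refine mul_le_mul ((abs_add_le _ _).trans ?_) b1 (abs_nonneg _) (by positivity)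
      rw [abs_mul, abs_mul, abs_mul, abs_mul, abs_mul, abs_of_nonneg (Real.sqrt_nonneg _)]
      have s1 := Real.abs_sin_le_one (π * p.2 / (ε * h p.1))
      have s2 := Real.abs_cos_le_one (π * p.2 / (ε * h p.1))
      have := hk p.1
      gcongr
  have i2 : IntegrableOn F2 O := by
    refine intg_of volume O hOo hvol F2 (((cx.pow 2).add (cy.pow 2)).sub
      (continuousOn_const.mul (hUc.pow 2))) (K ^ 2 + K ^ 2 + κ * K ^ 2) ?_
    intro p hpO
    obtain ⟨_, k1, k2⟩ := hK p hpO
    obtain ⟨b1, b2⟩ := aux_fd_le U K p k1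
    have q1 : (fderiv ℝ U p (1, 0)) ^ 2 ≤ K ^ 2 := by rw [← sq_abs]; gcongr
    have q2 : (fderiv ℝ U p (0, 1)) ^ 2 ≤ K ^ 2 := by rw [← sq_abs]; gcongr
    have q3 : κ * (U p) ^ 2 ≤ κ * K ^ 2 := by rw [← sq_abs]; gcongr
    have q4 : 0 ≤ κ * (U p) ^ 2 := by positivity
    have q5 := sq_nonneg (fderiv ℝ U p (1, 0))
    have q6 := sq_nonneg (fderiv ℝ U p (0, 1))
    have q7 : 0 ≤ κ * K ^ 2 := by positivity
    simp only [hF2]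
    rw [abs_le]; constructor <;> nlinarith
  rw [hOd] at i1 i2 hOm ⊢
  obtain ⟨f1, j1⟩ := fubini_region J hJo.measurableSet (fun x => ε * h x) hOm F1 i1
  obtain ⟨f2, j2⟩ := fubini_region J hJo.measurableSet (fun x => ε * h x) hOm F2 i2
  rw [f1, f2]
  set C1 := (2 * R * M + π * R + (2 + 2 * (R + π * R) ^ 2) + 2 * R ^ 3 * M) with hC1
  have hC10 : 0 ≤ C1 := by positivity
  have key : ∀ x ∈ J, 0 ≤ (∫ y in Ioo 0 (ε * h x), F2 (x, y)) ∧
      |∫ y in Ioo 0 (ε * h x), F1 (x, y)| ≤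
        C1 * (d * χ' x ^ 2 + χ x ^ 2 / d + d * ∫ y in Ioo 0 (ε * h x), F2 (x, y)) := by
    intro x hx
    have hL := hp x hx
    have hhx := hpos x (hJI hx)
    have conv : ∀ f : ℝ → ℝ, (∫ y in Ioo 0 (ε * h x), f y) = ∫ y in (0:ℝ)..(ε * h x), f y := by
      intro f; rw [intervalIntegral.integral_of_le hL.le, integral_Ioc_eq_integral_Ioo]
    rw [conv, conv]
    obtain ⟨s0, s1, s2⟩ := hsl x hx
    have hOx : ∀ y ∈ Ioo 0 (ε * h x), (x, y) ∈ O := fun y hy => (hmemO x y).2 ⟨hx, hy⟩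
    obtain ⟨o1, o2⟩ := slice_identity J hJo (fun x => ε * h x) (fun x => ε * deriv h x) (ε * B) hp
      (fun x hx => (hh x hx).const_mul ε)
      (fun x hx => by rw [abs_mul, abs_of_pos hε]; exact mul_le_mul_of_nonneg_left (hB x hx) hε.le)
      U K (fun x hx y hy => (hK _ ((hmemO x y).2 ⟨hx, hy⟩)).1)
      (fun x hx y hy => (hK _ ((hmemO x y).2 ⟨hx, hy⟩)).2.1)
      (fun x hx => (hsl x hx).1)
      (by filter_upwards [horth] with x hx hxJ using hx (hJI hxJ)) x hx
    have bx : ∀ y ∈ Ioo 0 (ε * h x), |fderiv ℝ U (x, y) (1, 0)| ≤ K := fun y hy =>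
      (aux_fd_le U K _ (hK _ (hOx y hy)).2.1).1
    have by' : ∀ y ∈ Ioo 0 (ε * h x), |fderiv ℝ U (x, y) (0, 1)| ≤ K := fun y hy =>
      (aux_fd_le U K _ (hK _ (hOx y hy)).2.1).2
    have mx := aux_meas_fd U x (1, 0)
    have my := aux_meas_fd U x (0, 1)
    have sqb : ∀ t : ℝ, |t| ≤ K → |t ^ 2| ≤ K ^ 2 := fun t ht => by
      rw [abs_pow]; gcongr
    have ix : IntervalIntegrable (fun y => (fderiv ℝ U (x, y) (1, 0)) ^ 2) volume 0 (ε * h x) :=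
      aux_ii _ (mx.pow_const 2) (K ^ 2) _ hL.le fun y hy => sqb _ (bx y hy)
    have iy : IntervalIntegrable (fun y => (fderiv ℝ U (x, y) (0, 1)) ^ 2) volume 0 (ε * h x) :=
      aux_ii _ (my.pow_const 2) (K ^ 2) _ hL.le fun y hy => sqb _ (by' y hy)
    have iu : IntervalIntegrable (fun y => U (x, y) ^ 2) volume 0 (ε * h x) := by
      refine ContinuousOn.intervalIntegrable ?_
      rw [uIcc_of_le hL.le]; exact s0.pow 2
    have P := poincare_sin (ε * h x) hL (fun y => U (x, y)) (fun y => fderiv ℝ U (x, y) (0, 1)) K s0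
      (fun y hy => (fd_slices U (x, y) (hK _ (hOx y hy)).1).2) by' s1 s2 iy o1
    have E2 : (∫ y in (0:ℝ)..(ε * h x), F2 (x, y)) =
        (∫ y in (0:ℝ)..(ε * h x), (fderiv ℝ U (x, y) (1, 0)) ^ 2) +
        (∫ y in (0:ℝ)..(ε * h x), (fderiv ℝ U (x, y) (0, 1)) ^ 2) -
        κ * ∫ y in (0:ℝ)..(ε * h x), U (x, y) ^ 2 := by
      simp only [hF2]
      rw [intervalIntegral.integral_sub (ix.add iy) (iu.const_mul κ),
        intervalIntegral.integral_add ix iy, intervalIntegral.integral_const_mul]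
    have A0 : 0 ≤ ∫ y in (0:ℝ)..(ε * h x), (fderiv ℝ U (x, y) (1, 0)) ^ 2 :=
      intervalIntegral.integral_nonneg hL.le fun y _ => sq_nonneg _
    have D0 : 0 ≤ ∫ y in (0:ℝ)..(ε * h x), (fderiv ℝ U (x, y) (0, 1)) ^ 2 :=
      intervalIntegral.integral_nonneg hL.le fun y _ => sq_nonneg _
    have Q0 : 0 ≤ ∫ y in (0:ℝ)..(ε * h x), U (x, y) ^ 2 :=
      intervalIntegral.integral_nonneg hL.le fun y _ => sq_nonneg _
    have hκL : 4 * κ ≤ 4 * π ^ 2 / (ε * h x) ^ 2 := by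
      have := hM x (hJI hx)
      rw [hκ, ← mul_div_assoc]
      apply div_le_div_of_nonneg_left (by positivity) (by positivity)
      rw [← mul_pow, mul_comm M]; gcongr
    have S := slice_bound (ε * h x) (Real.sqrt (2 / (ε * h x))) K (χ x) (χ' x) (deriv h x / h x) R M d
      hL (Real.sqrt_nonneg _) (by rw [Real.sq_sqrt (by positivity)]; field_simp) hM0 hd hd1
      (by
        rcases hcase with hc | hc
        · left
          have := hM x (hJI hx)
          calc ε * h x ≤ d * M := by gcongr
            _ = M * d := mul_comm _ _
        · right; exact hc)
      (hR x hx) _ _ mx my bx by'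
      (by rw [o2, mul_div_mul_left _ _ hε.ne'])
    have T : (∫ y in (0:ℝ)..(ε * h x), (fderiv ℝ U (x, y) (1, 0)) ^ 2) +
        3 / 4 * (∫ y in (0:ℝ)..(ε * h x), (fderiv ℝ U (x, y) (0, 1)) ^ 2) ≤
        (∫ y in (0:ℝ)..(ε * h x), F2 (x, y)) := by
      rw [E2]
      have := mul_le_mul_of_nonneg_right hκL Q0
      linarith
    refine ⟨le_trans (by positivity) T, ?_⟩
    refine S.trans ?_
    gcongr
  have e0 : 0 ≤ ∫ x in J, ∫ y in Ioo 0 (ε * h x), F2 (x, y) :=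
    setIntegral_nonneg hJo.measurableSet fun x hx => (key x hx).1
  refine ⟨e0, ?_⟩
  have hJv : volume J < ⊤ := lt_of_le_of_lt (measure_mono hJI) isCompact_Icc.measure_lt_top
  have k1 : IntegrableOn (fun x => χ' x ^ 2) J := intg_of volume J hJo hJv _ (by fun_prop) (Kχ ^ 2)
    fun p _ => by rw [abs_pow]; have := hk' p; gcongr
  have k2 : IntegrableOn (fun x => χ x ^ 2) J := intg_of volume J hJo hJv _ (by fun_prop) (Kχ ^ 2)
    fun p _ => by rw [abs_pow]; have := hk p; gcongr
  have k12 : IntegrableOn (fun x => d * χ' x ^ 2 + χ x ^ 2 / d) J :=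
    (k1.const_mul d).add (k2.div_const d)
  have k3 : IntegrableOn (fun x => C1 * (d * χ' x ^ 2 + χ x ^ 2 / d +
      d * ∫ y in Ioo 0 (ε * h x), F2 (x, y))) J :=
    (((k1.const_mul d).add (k2.div_const d)).add (j2.const_mul d)).const_mul C1
  calc |∫ x in J, ∫ y in Ioo 0 (ε * h x), F1 (x, y)|
      ≤ ∫ x in J, |∫ y in Ioo 0 (ε * h x), F1 (x, y)| := abs_integral_le_integral_abs
    _ ≤ ∫ x in J, C1 * (d * χ' x ^ 2 + χ x ^ 2 / d + d * ∫ y in Ioo 0 (ε * h x), F2 (x, y)) :=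
        setIntegral_mono_on j1.abs k3 hJo.measurableSet fun x hx => (key x hx).2
    _ = _ := by
        rw [MeasureTheory.integral_const_mul, MeasureTheory.integral_add
          k12 (j2.const_mul d),
          MeasureTheory.integral_add (k1.const_mul d) (k2.div_const d),
          MeasureTheory.integral_const_mul, MeasureTheory.integral_const_mul,
          MeasureTheory.integral_div]


lemma final_arith (C1 P1 P2 : ℝ) (p1 : 0 ≤ P1) (p2 : 0 ≤ P2) (hC1 : 0 ≤ C1) (d t q e X Y : ℝ)
    (hd0 : 0 < d) (hd : d = min 1 t) (q0 : 0 ≤ q) (E0 : 0 ≤ e) (Q1 : Y ≤ q)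
    (Q2 : X ≤ P1 * q) (Q3 : X ≤ P2 * t ^ 2 * q) :
    C1 * (d * Y + X / d + d * e) ≤ C1 * (1 + (P1 + P2)) * t * (q + e) := by
  have hdt : d ≤ t := hd ▸ min_le_right _ _
  have Q4 : X ≤ (P1 + P2) * d ^ 2 * q := by
    rcases min_cases 1 t with ⟨h', _⟩ | ⟨h', _⟩
    · rw [hd, h']
      have := mul_nonneg p2 q0
      linarith
    · rw [hd, h']
      have := mul_nonneg (mul_nonneg p1 (sq_nonneg t)) q0
      linarith
  have X1 : X / d ≤ (P1 + P2) * d * q := by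
    rw [div_le_iff₀ hd0]; linarith
  calc C1 * (d * Y + X / d + d * e) ≤ C1 * (d * q + (P1 + P2) * d * q + d * e) := by gcongr
    _ ≤ C1 * ((1 + (P1 + P2)) * d * (q + e)) := by
        have := mul_nonneg (add_nonneg p1 p2) (mul_nonneg hd0.le E0)
        gcongr; linarith
    _ ≤ C1 * ((1 + (P1 + P2)) * t * (q + e)) := by gcongr
    _ = _ := by ring

/-- **Estimate (3.11)** (Friedlander–Solomyak). The off-diagonal term
`m_ε[ψ] = ∫_{Ω_ε} ∂ₓψ_χ ∂ₓU` satisfies `|m_ε[ψ]| ≤ C' ε^α b_ε[ψ]`, i.e. it is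
bounded by `C' ε^α` times the sum of the quadratic forms
`q_ε[χ] = ∫_I (χ'² + W_ε χ²)` and `∫_{Ω_ε} (|∇U|² − (π²/(M²ε²)) U²)`,
with `C'` independent of `ε`. -/
theorem off_diagonal_form_estimate
    (a b : ℝ) (ha : 0 < a) (hb : 0 < b)
    (h : ℝ → ℝ)
    (hcont : ContinuousOn h (Icc (-a) b))
    (hpos : ∀ x ∈ Icc (-a) b, 0 < h x)
    (hmax : ∀ x ∈ Icc (-a) b, x ≠ 0 → h x < h 0)
    (hC1 : ContDiffOn ℝ 1 h (Icc (-a) b \ {0}))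
    (hbd : ∃ B : ℝ, ∀ x ∈ Icc (-a) b \ {(0 : ℝ)}, |deriv h x| ≤ B)
    (m cp cm K η : ℝ)
    (hm : 1 ≤ m) (hcp : 0 < cp) (hcm : 0 < cm) (hK : 0 < K) (hη : 0 < η)
    (hexp_pos : ∀ x : ℝ, 0 < x → x ≤ η →
      |h x - (h 0 - cp * x ^ m)| ≤ K * x ^ (m + 1))
    (hexp_neg : ∀ x : ℝ, -η ≤ x → x < 0 →
      |h x - (h 0 - cm * |x| ^ m)| ≤ K * |x| ^ (m + 1))
    (α : ℝ) (hα : α = 2 / (m + 2)) :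
    ∃ C' : ℝ, 0 < C' ∧ ∀ ε : ℝ, 0 < ε →
      ∀ χ : ℝ → ℝ, ContDiff ℝ (⊤ : ℕ∞) χ → HasCompactSupport χ →
        tsupport χ ⊆ Ioo (-a) b →
      ∀ U : ℝ × ℝ → ℝ,
        ContDiffOn ℝ 1 U
          (closure {p : ℝ × ℝ | p.1 ∈ Icc (-a) b ∧ 0 < p.2 ∧ p.2 < ε * h p.1}) →
        (∀ p ∈ frontier {p : ℝ × ℝ | p.1 ∈ Icc (-a) b ∧ 0 < p.2 ∧ p.2 < ε * h p.1},
          U p = 0) →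
        (∀ᵐ x : ℝ, x ∈ Icc (-a) b →
          ∫ y in (0:ℝ)..(ε * h x), U (x, y) * Real.sin (π * y / (ε * h x)) = 0) →
        |∫ p in {p : ℝ × ℝ | p.1 ∈ Icc (-a) b ∧ 0 < p.2 ∧ p.2 < ε * h p.1},
            deriv (fun s => χ s * Real.sqrt (2 / (ε * h s)) *
              Real.sin (π * p.2 / (ε * h s))) p.1 *
            deriv (fun s => U (s, p.2)) p.1|
          ≤ C' * ε ^ α *
              ((∫ x in Icc (-a) b,
                  (deriv χ x ^ 2 +
                    (π ^ 2 / ε ^ 2 * (((h x) ^ 2)⁻¹ - ((h 0) ^ 2)⁻¹) +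
                      (π ^ 2 / 3 + 1 / 4) * (deriv h x) ^ 2 / (h x) ^ 2) * χ x ^ 2)) +
                ∫ p in {p : ℝ × ℝ | p.1 ∈ Icc (-a) b ∧ 0 < p.2 ∧ p.2 < ε * h p.1},
                  (gradSq U p - π ^ 2 / ((h 0) ^ 2 * ε ^ 2) * U p ^ 2)) := by
  have hpi := Real.pi_pos
  have hab : -a ≤ b := by linarith
  have h0I : (0:ℝ) ∈ Icc (-a) b := ⟨by linarith, hb.le⟩
  have hM0 : 0 < h 0 := hpos 0 h0I
  have hM : ∀ x ∈ Icc (-a) b, h x ≤ h 0 := by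
    intro x hx
    by_cases hx0 : x = 0
    · rw [hx0]
    · exact (hmax x hx hx0).le
  obtain ⟨h1, hh1, hlow⟩ : ∃ h1, 0 < h1 ∧ ∀ x ∈ Icc (-a) b, h1 ≤ h x := by
    obtain ⟨x0, hx0, hmin⟩ := isCompact_Icc.exists_isMinOn ⟨0, h0I⟩ hcont
    exact ⟨h x0, hpos x0 hx0, fun x hx => hmin hx⟩
  obtain ⟨B, hB⟩ := hbd
  obtain ⟨c, hc, hgl⟩ := g_lower a b ha hb h hcont hpos hmax m cp cm K η hm hcp hcm hK hη
    hexp_pos hexp_neg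
  have hbI : b ∈ Icc (-a) b \ {(0:ℝ)} := ⟨⟨hab, le_rfl⟩, hb.ne'⟩
  have hB0 : 0 ≤ B := (abs_nonneg _).trans (hB b hbI)
  set J : Set ℝ := Ioo (-a) b \ {0} with hJ
  have hJs : J ⊆ Icc (-a) b \ {0} := fun x hx => ⟨Ioo_subset_Icc_self hx.1, hx.2⟩
  have hJI : J ⊆ Icc (-a) b := fun x hx => Ioo_subset_Icc_self hx.1
  have hJo : IsOpen J := isOpen_Ioo.sdiff isClosed_singleton
  have hC1J : ContDiffOn ℝ 1 h J := hC1.mono hJs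
  have hh : ∀ x ∈ J, HasDerivAt h (deriv h x) x := fun x hx =>
    ((hC1J.differentiableOn one_ne_zero).differentiableAt (hJo.mem_nhds hx)).hasDerivAt
  have hdc : ContinuousOn (deriv h) J := hC1J.continuousOn_deriv_of_isOpen hJo le_rfl
  set R := B / h1 with hRd
  have hR0 : 0 ≤ R := by positivity
  have hR : ∀ x ∈ J, |deriv h x / h x| ≤ R := by
    intro x hx
    have := hB x (hJs hx)
    have := hlow x (hJI hx)
    rw [abs_div, abs_of_pos (hpos x (hJI hx))]
    exact div_le_div₀ hB0 (hB x (hJs hx)) hh1 this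
  set C1 := (2 * R * h 0 + π * R + (2 + 2 * (R + π * R) ^ 2) + 2 * R ^ 3 * h 0) with hC1d
  have hC10 : 0 < C1 := by positivity
  set C2 := 4 * (a + b) ^ 2 + 2 * (1 + 2 * 4 ^ m / (c * π ^ 2)) with hC2
  have hC20 : 0 < C2 := by positivity
  have hJv : volume J < ⊤ := lt_of_le_of_lt (measure_mono hJI) isCompact_Icc.measure_lt_top
  have hJae : (Icc (-a) b : Set ℝ) =ᵐ[volume] J := by
    have hae : ∀ᵐ x : ℝ, x ∉ ({-a, b, 0} : Set ℝ) :=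
      (Set.Finite.countable (by simp)).ae_notMem volume
    filter_upwards [hae] with x hx
    simp only [mem_insert_iff, mem_singleton_iff, not_or] at hx
    apply propext
    change x ∈ Icc (-a) b ↔ x ∈ J
    refine ⟨fun hq => ?_, fun hq => hJI hq⟩
    exact ⟨⟨lt_of_le_of_ne hq.1 (Ne.symm hx.1), lt_of_le_of_ne hq.2 hx.2.1⟩, hx.2.2⟩
  have conv : ∀ f : ℝ → ℝ, (∫ x in J, f x) = ∫ x in (-a)..b, f x := by
    intro f
    rw [← setIntegral_congr_set hJae, intervalIntegral.integral_of_le hab,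
      integral_Icc_eq_integral_Ioc]
  have hα0 : 0 ≤ α := by rw [hα]; positivity
  have hα1 : α ≤ 1 := by rw [hα, div_le_one (by positivity)]; linarith
  refine ⟨C1 * (1 + C2), by positivity, ?_⟩
  intro ε hε χ hχ hcs hts U hU hU0 horth
  set d := min 1 (ε ^ α) with hd
  have hεα : 0 < ε ^ α := Real.rpow_pos_of_pos hε _
  have hd0 : 0 < d := lt_min one_pos hεα
  have hd1 : d ≤ 1 := min_le_left _ _
  have hdε : d ≤ ε ^ α := min_le_right _ _
  have hcase : ε ≤ d ∨ d = 1 := by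
    rcases le_total ε 1 with h' | h'
    · left
      refine le_min h' ?_
      calc ε = ε ^ (1:ℝ) := (Real.rpow_one ε).symm
        _ ≤ ε ^ α := Real.rpow_le_rpow_of_exponent_ge hε h' hα1
    · right; exact min_eq_left (Real.one_le_rpow h' hα0)
  have hχd : ∀ x, HasDerivAt χ (deriv χ x) x := fun x =>
    ((hχ.differentiable (by simp)) x).hasDerivAt
  have hχc : Continuous (deriv χ) := hχ.continuous_deriv (by exact_mod_cast le_top)
  obtain ⟨K1, hK1⟩ := hcs.exists_bound_of_continuous hχ.continuous
  obtain ⟨K2, hK2⟩ := hcs.deriv.exists_bound_of_continuous hχc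
  obtain ⟨E0, E1⟩ := core a b ε hε h hcont (h 0) hM0 hM h1 hh1 hlow U _ J _ rfl hJ rfl hU hU0 horth
    B R hh hdc (fun x hx => hB x (hJs hx)) hR0 hR χ (deriv χ) hχd hχc (max K1 K2)
    (fun x => (hK1 x).trans (le_max_left _ _)) (fun x => (hK2 x).trans (le_max_right _ _))
    d hd0 hd1 hcase
  have hz : ∀ x, x ∉ Ioo (-a) b → χ x = 0 := fun x hx =>
    image_eq_zero_of_notMem_tsupport fun hx' => hx (hts hx')
  set w : ℝ → ℝ := fun x => deriv χ x ^ 2 +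
                    (π ^ 2 / ε ^ 2 * (((h x) ^ 2)⁻¹ - ((h 0) ^ 2)⁻¹) +
                      (π ^ 2 / 3 + 1 / 4) * (deriv h x) ^ 2 / (h x) ^ 2) * χ x ^ 2 with hw
  have hwi : IntegrableOn w J := by
    have chJ : ContinuousOn h J := hcont.mono hJI
    have hne : ∀ x ∈ J, (h x) ^ 2 ≠ 0 := fun x hx => pow_ne_zero 2 (hpos x (hJI hx)).ne'
    refine intg_of volume J hJo hJv w ?_ (K2 ^ 2 + (π ^ 2 / ε ^ 2 * (h1 ^ 2)⁻¹ +
      (π ^ 2 / 3 + 1 / 4) * R ^ 2) * K1 ^ 2) ?_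
    · have c1 : ContinuousOn (fun x => ((h x) ^ 2)⁻¹) J := (chJ.pow 2).inv₀ hne
      have c2 : ContinuousOn (fun x => (π ^ 2 / 3 + 1 / 4) * (deriv h x) ^ 2 / (h x) ^ 2) J :=
        (continuousOn_const.mul (hdc.pow 2)).div (chJ.pow 2) hne
      exact (hχc.continuousOn.pow 2).add (((continuousOn_const.mul (c1.sub continuousOn_const)).add
        c2).mul (hχ.continuous.continuousOn.pow 2))
    · intro x hx
      have hxp := hpos x (hJI hx)
      have a1 : ((h 0) ^ 2)⁻¹ ≤ ((h x) ^ 2)⁻¹ := by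
        have := hM x (hJI hx)
        gcongr
      have a2 : ((h x) ^ 2)⁻¹ ≤ (h1 ^ 2)⁻¹ := by
        have := hlow x (hJI hx)
        gcongr
      have a3 : 0 ≤ ((h 0) ^ 2)⁻¹ := by positivity
      have a4 : (π ^ 2 / 3 + 1 / 4) * (deriv h x) ^ 2 / (h x) ^ 2 ≤ (π ^ 2 / 3 + 1 / 4) * R ^ 2 := by
        rw [mul_div_assoc, ← div_pow, ← sq_abs (deriv h x / h x)]
        have := hR x hx
        gcongr
      have a5 : deriv χ x ^ 2 ≤ K2 ^ 2 := by
        rw [← sq_abs]; have := hK2 x; rw [Real.norm_eq_abs] at this; gcongr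
      have a6 : χ x ^ 2 ≤ K1 ^ 2 := by
        rw [← sq_abs]; have := hK1 x; rw [Real.norm_eq_abs] at this; gcongr
      have a7 : 0 ≤ ((h x) ^ 2)⁻¹ - ((h 0) ^ 2)⁻¹ := by linarith
      have a8 : ((h x) ^ 2)⁻¹ - ((h 0) ^ 2)⁻¹ ≤ (h1 ^ 2)⁻¹ := by linarith
      have hw0 : 0 ≤ w x := by simp only [hw]; positivity
      rw [abs_of_nonneg hw0]
      simp only [hw]
      gcongr
  have hwii : IntervalIntegrable w volume (-a) b := by
    rw [intervalIntegrable_iff_integrableOn_Icc_of_le hab]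
    exact hwi.congr_set_ae hJae
  obtain ⟨Q1, Q2, Q3⟩ := q_lower a b m α c ε ha hb hm hα hc hε χ (deriv χ) hχd hχc
    (hz _ (by simp)) (hz _ (by simp)) w hwii (by
      intro x hx hx0
      have g1 := hgl x (Ioo_subset_Icc_self hx)
      have g2 : 0 ≤ (π ^ 2 / 3 + 1 / 4) * (deriv h x) ^ 2 / (h x) ^ 2 := by positivity
      have g3 : π ^ 2 / ε ^ 2 * (c * |x| ^ m) ≤ π ^ 2 / ε ^ 2 * (((h x) ^ 2)⁻¹ - ((h 0) ^ 2)⁻¹) := by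
        gcongr
      simp only [hw]
      have g4 := mul_le_mul_of_nonneg_right (g3.trans (le_add_of_nonneg_right g2)) (sq_nonneg (χ x))
      linarith)
  rw [conv, conv] at E1
  rw [setIntegral_congr_set hJae, conv]
  have q0 : 0 ≤ ∫ x in (-a)..b, w x :=
    (intervalIntegral.integral_nonneg hab fun x _ => sq_nonneg _).trans Q1
  generalize (∫ x in (-a)..b, w x) = q at *
  refine E1.trans ?_
  generalize (∫ p in {p : ℝ × ℝ | p.1 ∈ Icc (-a) b ∧ 0 < p.2 ∧ p.2 < ε * h p.1},
                  (gradSq U p - π ^ 2 / ((h 0) ^ 2 * ε ^ 2) * U p ^ 2)) = e at *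
  exact final_arith _ _ _ (by positivity) (by positivity) hC10.le d (ε ^ α) q e _ _ hd0 hd q0 E0 Q1 Q2 Q3
end
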